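/- (Existence.) Let C be a diamond category, W a narrow formation of finite complexity, and (M_G)_{G∈W} real numbers that are well-behaved at W and satisfy v_{W,F} ≥ 0 for all F ∈ W. Then setting ν_W({F}) = v_{W,F} defines a measure ν_W on the (countable) set W, equipped with the discrete σ-algebra, whose G-moment ∑_{F∈W} |Epi(F,G)| ν_W({F}) equals M_G for every G ∈ W. Moreover, for any formation W' ⊆ W there exists a measure on W' with G-moment M_G for every G ∈ W'. -/

import Mathlib

open CategoryTheory Opposite Filter Topology MeasureTheory
open scoped ENNReal Classical

universe u

namespace MomentCat

variable {C : Type u} [SmallCategory C]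

/-- The poset of isomorphism classes of quotient objects of `G`,
realized as subobjects of `op G` in `Cᵒᵖ`.  The order is: `a ≤ b` iff `a` is a
further quotient of `b`, so that `⊤` is the class of the identity `G → G`. -/
abbrev Quotients (G : C) := Subobject (op G)

/-- The join of two quotient classes (the least upper bound, when it exists). -/
noncomputable def qSup {G : C} (a b : Quotients G) : Quotients G :=
  if h : ∃ c, IsLUB {a, b} c then h.choose else a

/-- The meet of two quotient classes (the greatest lower bound, when it exists). -/
noncomputable def qInf {G : C} (a b : Quotients G) : Quotients G :=
  if h : ∃ c, IsGLB {a, b} c then h.choose else a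

/-- The join of a set of quotient classes (when it exists). -/
noncomputable def qsSup {G : C} (s : Set (Quotients G)) : Quotients G :=
  if h : ∃ c, IsLUB s c then h.choose else ⊤

/-- The quotient class determined by an epimorphism `π : G ⟶ F`. -/
noncomputable def quotOf {G F : C} (π : G ⟶ F) (h : Epi π) : Quotients G :=
  haveI := h
  Subobject.mk π.op

/-- The underlying object of a quotient class. -/
noncomputable def qObj {G : C} (a : Quotients G) : C :=
  unop (Subobject.underlying.obj a)

/-- An object is minimal if its only quotient is itself. -/
def IsMinimalObj (G : C) : Prop := Subsingleton (Quotients G)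

/-- An epimorphism is simple if it is not an isomorphism and the interval
`[F, G]` contains only the two endpoints. -/
def IsSimpleEpi {G F : C} (π : G ⟶ F) : Prop :=
  ∃ h : Epi π, ¬IsIso π ∧ ∀ X : Quotients G, quotOf π h ≤ X → X = quotOf π h ∨ X = ⊤

/-- The interval `[a, ⊤]` is a complemented lattice. -/
def IntervalComplTop {G : C} (a : Quotients G) : Prop :=
  ∀ X : Quotients G, a ≤ X → ∃ Y : Quotients G, a ≤ Y ∧ qSup X Y = ⊤ ∧ qInf X Y = a

/-- The interval `[a, b]` is a complemented lattice. -/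
def IntervalCompl {G : C} (a b : Quotients G) : Prop :=
  ∀ X : Quotients G, a ≤ X → X ≤ b →
    ∃ Y : Quotients G, a ≤ Y ∧ Y ≤ b ∧ qSup X Y = b ∧ qInf X Y = a

/-- An epimorphism `π : G ⟶ F` is semisimple if the interval `[F,G]` is complemented. -/
def IsSemisimpleEpi {G F : C} (π : G ⟶ F) : Prop :=
  ∃ h : Epi π, IntervalComplTop (quotOf π h)

/-- A set of objects (stable under isomorphism) closed under quotients. -/
def DownwardClosed (S : Set C) : Prop :=
  ∀ G ∈ S, ∀ (F : C) (π : G ⟶ F), Epi π → F ∈ S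

/-- A set of objects closed under joins of quotients of a common object. -/
def JoinClosed (S : Set C) : Prop :=
  ∀ (G : C) (a b : Quotients G), qObj a ∈ S → qObj b ∈ S →
    (∃ c, IsLUB {a, b} c) → qObj (qSup a b) ∈ S

/-- A set of objects containing all minimal objects. -/
def MinClosed (S : Set C) : Prop := ∀ G : C, IsMinimalObj G → G ∈ S

/-- A formation: downward-closed, join-closed, containing all minimal objects. -/
def IsFormation (S : Set C) : Prop := DownwardClosed S ∧ JoinClosed S ∧ MinClosed S

/-- The smallest downward-closed join-closed set containing `B` and all minimal objects. -/
def levelGen (B : Set C) : Set C := ⋂₀ {S : Set C | IsFormation S ∧ B ⊆ S}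

/-- A level is a formation generated by a finite set of objects. -/
def IsLevel (S : Set C) : Prop := ∃ B : Set C, B.Finite ∧ S = levelGen B

/-- The type of isomorphism classes of objects of `C`. -/
abbrev IsoCls (C : Type u) [SmallCategory C] := Quotient (CategoryTheory.isIsomorphicSetoid C)

/-- The isomorphism class of an object. -/
def cls (G : C) : IsoCls C := Quotient.mk (CategoryTheory.isIsomorphicSetoid C) G

/-- The set of epimorphisms from `G` to `F`. -/
abbrev Epis (G F : C) := {π : G ⟶ F // Epi π}

/-- There is a chain of covers of length `d` from `a` to `b` (i.e. the morphism
`qObj b → qObj a` has dimension `d`). -/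
def CovChain {G : C} (a b : Quotients G) (d : ℕ) : Prop :=
  ∃ c : Fin (d + 1) → Quotients G, c 0 = a ∧ c (Fin.last d) = b ∧
    ∀ i : Fin d, c i.castSucc ⋖ c i.succ

/-- An epimorphism has dimension `d`. -/
def EpiDim {G F : C} (π : G ⟶ F) (h : Epi π) (d : ℕ) : Prop :=
  CovChain (quotOf π h) ⊤ d

/-- A set of isomorphism classes is narrow if each of its members receives simple
epimorphisms from only finitely many of its members (up to isomorphism). -/
def Narrow (S : Set C) : Prop :=
  ∀ G ∈ S, {X : IsoCls C | X.out ∈ S ∧ ∃ π : X.out ⟶ G, IsSimpleEpi π}.Finite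

/-- The minimal quotient: the bottom of the quotient poset, when it exists. -/
noncomputable def qBot (G : C) : Quotients G :=
  if h : ∃ b : Quotients G, ∀ x, b ≤ x then h.choose else ⊤

/-- `G` has complexity at most `k`: the map to the minimal quotient is a
composition of `k` semisimple epimorphisms. -/
def complexityLE (G : C) (k : ℕ) : Prop :=
  ∃ c : Fin (k + 1) → Quotients G, c 0 = qBot G ∧ c (Fin.last k) = ⊤ ∧
    ∀ i : Fin k, c i.castSucc ≤ c i.succ ∧ IntervalCompl (c i.castSucc) (c i.succ)

/-- A diamond category. -/
structure IsDiamond (C : Type u) [SmallCategory C] : Prop where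
  /-- quotient posets are finite … -/
  quotFinite : ∀ G : C, Finite (Quotients G)
  /-- … and are lattices: all pairwise joins exist … -/
  lub : ∀ (G : C) (a b : Quotients G), ∃ c, IsLUB {a, b} c
  /-- … and all pairwise meets exist … -/
  glb : ∀ (G : C) (a b : Quotients G), ∃ c, IsGLB {a, b} c
  /-- … and are modular. -/
  modular : ∀ (G : C) (a b x : Quotients G), a ≤ b →
    qSup a (qInf x b) = qInf (qSup a x) b
  /-- automorphism groups are finite -/
  autFinite : ∀ G : C, Finite (Aut G)
  /-- levels are narrow -/
  levelNarrow : ∀ S : Set C, IsLevel S → Narrow S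
  /-- countably many isomorphism classes of minimal objects -/
  minCountable : Set.Countable {X : IsoCls C | IsMinimalObj X.out}

/-- A family assigning to each object the Möbius function of its quotient poset:
`mob G x x = 1` and for `x < y`, `∑_{x ≤ z ≤ y} mob G x z = 0`. -/
def IsMobiusFamily (mob : ∀ G : C, Quotients G → Quotients G → ℝ) : Prop :=
  ∀ G : C, (∀ x : Quotients G, mob G x x = 1) ∧
    ∀ x y : Quotients G, x < y → ∑ᶠ z ∈ Set.Icc x y, mob G x z = 0

/-- `μ(π) = μ(F, G)` for an epimorphism `π : G ⟶ F`. -/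
noncomputable def muEpi (mob : ∀ G : C, Quotients G → Quotients G → ℝ)
    {G F : C} (π : G ⟶ F) (h : Epi π) : ℝ :=
  mob G (quotOf π h) ⊤

/-- `μ̂(F,G) = ∑_{π ∈ Epi(G,F)/Aut(F)} μ(π) = (∑_{π ∈ Epi(G,F)} μ(π))/|Aut F|`
(the `Aut F`-action on epimorphisms being free). -/
noncomputable def muHat (mob : ∀ G : C, Quotients G → Quotients G → ℝ) (F G : C) : ℝ :=
  (∑' π : Epis G F, muEpi mob π.1 π.2) / (Nat.card (Aut F) : ℝ)

/-- `S_{G,F} = |Epi(G,F)|/|Aut F|`. -/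
noncomputable def SQ (G F : C) : ℝ :=
  (Nat.card (Epis G F) : ℝ) / (Nat.card (Aut F) : ℝ)

/-- `T_{G,F} = μ̂(F,G)`. -/
noncomputable def TQ (mob : ∀ G : C, Quotients G → Quotients G → ℝ) (G F : C) : ℝ :=
  muHat mob F G

/-- `Z(π)`: the number of `H ∈ [F,G]` satisfying the distributive law. -/
noncomputable def Zfn {G F : C} (π : G ⟶ F) (h : Epi π) : ℕ :=
  Nat.card {H : Quotients G // quotOf π h ≤ H ∧ ∀ K₁ K₂ : Quotients G,
    quotOf π h ≤ K₁ → quotOf π h ≤ K₂ →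
      qSup H (qInf K₁ K₂) = qInf (qSup H K₁) (qSup H K₂)}

/-- The isomorphism classes lying in `W`. -/
abbrev WSub (W : Set C) := {X : IsoCls C // X.out ∈ W}

/-- `(M_G)` is well-behaved at `W`:
`∑_{G ∈ W} ∑_{π ∈ Epi(G,F)} (|μ(F,G)|/|Aut G|) Z(π)³ |M_G| < ∞` for every `F ∈ W`. -/
def WellBehavedAt (mob : ∀ G : C, Quotients G → Quotients G → ℝ) (M : IsoCls C → ℝ)
    (W : Set C) : Prop :=
  ∀ F : C, F ∈ W → Summable (fun q : Σ X : WSub W, Epis X.1.out F =>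
    |mob q.1.1.out (quotOf q.2.1 q.2.2) ⊤| / (Nat.card (Aut q.1.1.out) : ℝ)
      * ((Zfn q.2.1 q.2.2 : ℝ)) ^ 3 * |M q.1.1|)

/-- The `W`-quotient `G^W`: the join of all quotients of `G` lying in `W`. -/
noncomputable def wQuot (W : Set C) (G : C) : Quotients G :=
  qsSup {a : Quotients G | qObj a ∈ W}

/-- An epimorphism `φ : G ⟶ E` is relative-`W` if `G → G^W ∨ E` is an isomorphism. -/
def RelativeW (W : Set C) {G E : C} (φ : G ⟶ E) (h : Epi φ) : Prop :=
  qSup (wQuot W G) (quotOf φ h) = ⊤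

/-- `v_{W,F} = ∑_{G ∈ W} μ̂(F,G) M_G / |Aut G|`. -/
noncomputable def vWF (mob : ∀ G : C, Quotients G → Quotients G → ℝ) (M : IsoCls C → ℝ)
    (W : Set C) (F : C) : ℝ :=
  ∑' X : WSub W, muHat mob F X.1.out * M X.1 / (Nat.card (Aut X.1.out) : ℝ)

theorem epiComp {G F E : C} {π : G ⟶ F} {ρ : F ⟶ E} (h1 : Epi π) (h2 : Epi ρ) :
    Epi (π ≫ ρ) := by
  haveI := h1; haveI := h2; infer_instance

/-- The radical of an epimorphism with class `a`: the join of all minimal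
elements of `[a, ⊤]` distinct from `a` (together with `a` itself). -/
noncomputable def radicalEl {G : C} (a : Quotients G) : Quotients G :=
  qsSup (insert a {X : Quotients G | a ⋖ X})

end MomentCat

namespace MomentCat

/-- the discrete σ-algebra on the isomorphism classes lying in `W` -/
instance instMeasWSub {C : Type u} [SmallCategory C] (W : Set C) :
    MeasurableSpace (WSub W) := ⊤

end MomentCat


namespace MomentLat

set_option linter.unusedSectionVars false
set_option linter.unusedSimpArgs false

section
variable {α : Type*} [Lattice α] [IsModularLattice α] [OrderTop α] [Fintype α]

/-- (left) Moebius function -/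
def Mob (m : α → α → ℝ) : Prop :=
  (∀ x, m x x = 1) ∧
    ∀ x y, x < y → ∑ z ∈ Finset.univ.filter (fun z => x ≤ z ∧ z ≤ y), m x z = 0

theorem weisner {m : α → α → ℝ} (hm : Mob m) {x p : α} (hxp : x < p) :
    ∀ t, p ≤ t → ∑ y ∈ Finset.univ.filter (fun y => x ≤ y ∧ y ⊔ p = t), m x y = 0 := by
  intro t
  induction t using WellFoundedLT.induction with
  | ind t ih =>
    intro hpt
    have h0 := hm.2 x t (hxp.trans_le hpt)
    rw [← Finset.sum_fiberwise_of_maps_to (s := Finset.univ.filter (fun z => x ≤ z ∧ z ≤ t))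
      (t := Finset.univ.filter (fun s => p ≤ s ∧ s ≤ t)) (g := fun y => y ⊔ p)] at h0
    · rw [Finset.sum_eq_single t] at h0
      · rw [← h0]
        apply Finset.sum_congr _ (fun _ _ => rfl)
        ext y
        simp only [Finset.mem_filter, Finset.mem_univ, true_and]
        constructor
        · rintro ⟨h1, h2⟩
          exact ⟨⟨h1, h2 ▸ le_sup_left⟩, h2⟩
        · rintro ⟨⟨h1, _⟩, h2⟩
          exact ⟨h1, h2⟩
      · intro s hs hst
        simp only [Finset.mem_filter, Finset.mem_univ, true_and] at hs
        rw [← ih s (lt_of_le_of_ne hs.2 hst) hs.1]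
        apply Finset.sum_congr _ (fun _ _ => rfl)
        ext y
        simp only [Finset.mem_filter, Finset.mem_univ, true_and]
        constructor
        · rintro ⟨⟨h1, _⟩, h2⟩
          exact ⟨h1, h2⟩
        · rintro ⟨h1, h2⟩
          exact ⟨⟨h1, (h2 ▸ le_sup_left : y ≤ s).trans hs.2⟩, h2⟩
      · intro h
        simp [hpt] at h
    · intro y hy
      simp only [Finset.mem_filter, Finset.mem_univ, true_and, Finset.coe_filter] at hy ⊢
      exact ⟨le_sup_right, sup_le hy.2 hpt⟩

theorem right_rel {m : α → α → ℝ} (hm : Mob m) (x : α) (hx : x ≠ ⊤) :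
    ∑ y ∈ Finset.univ.filter (fun y => x ≤ y), m y ⊤ = 0 := by
  let A : Matrix α α ℝ := Matrix.of (fun x y => if x ≤ y then m x y else 0)
  let Z : Matrix α α ℝ := Matrix.of (fun x y => if x ≤ y then 1 else 0)
  have h1 : A * Z = 1 := by
    ext x y
    simp only [Matrix.mul_apply, A, Z, Matrix.of_apply, Matrix.one_apply, mul_ite, mul_one, mul_zero]
    rw [Finset.sum_congr rfl (g := fun z => if x ≤ z ∧ z ≤ y then m x z else 0)]
    · rw [← Finset.sum_filter]
      split_ifs with h
      · subst h
        have : Finset.univ.filter (fun z => x ≤ z ∧ z ≤ x) = {x} := by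
          ext z; simp [le_antisymm_iff, and_comm]
        rw [this]; simp [hm.1]
      · by_cases hxy : x ≤ y
        · exact hm.2 x y (lt_of_le_of_ne hxy h)
        · apply Finset.sum_eq_zero
          intro z hz
          simp only [Finset.mem_filter, Finset.mem_univ, true_and] at hz
          exact absurd (hz.1.trans hz.2) hxy
    · intro z _
      by_cases h1 : x ≤ z <;> by_cases h2 : z ≤ y <;> simp [h1, h2]
  have h2 := mul_eq_one_comm.mp h1
  have h3 := congrFun (congrFun h2 x) ⊤
  simp only [Matrix.mul_apply, A, Z, Matrix.of_apply, Matrix.one_apply, hx, if_false] at h3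
  rw [← h3, Finset.sum_filter]
  apply Finset.sum_congr rfl
  intro z _
  by_cases h1 : x ≤ z <;> simp [h1]

theorem weisner' {m : α → α → ℝ} (hm : Mob m) {A : α} (hA : A ≠ ⊤) :
    ∀ t, t ≤ A → ∑ y ∈ Finset.univ.filter (fun y => y ⊓ A = t), m y ⊤ = 0 := by
  intro t
  induction t using WellFoundedGT.induction with
  | ind t ih =>
    intro hpt
    have ht : t ≠ ⊤ := fun h => hA (top_le_iff.mp (h ▸ hpt))
    have h0 := right_rel hm t ht
    rw [← Finset.sum_fiberwise_of_maps_to (s := Finset.univ.filter (fun z => t ≤ z))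
      (t := Finset.univ.filter (fun s => t ≤ s ∧ s ≤ A)) (g := fun y => y ⊓ A)] at h0
    · rw [Finset.sum_eq_single t] at h0
      · rw [← h0]
        apply Finset.sum_congr _ (fun _ _ => rfl)
        ext y
        simp only [Finset.mem_filter, Finset.mem_univ, true_and]
        constructor
        · intro h2
          exact ⟨h2 ▸ inf_le_left, h2⟩
        · rintro ⟨_, h2⟩
          exact h2
      · intro s hs hst
        simp only [Finset.mem_filter, Finset.mem_univ, true_and] at hs
        rw [← ih s (lt_of_le_of_ne hs.1 (Ne.symm hst)) hs.2]
        apply Finset.sum_congr _ (fun _ _ => rfl)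
        ext y
        simp only [Finset.mem_filter, Finset.mem_univ, true_and]
        constructor
        · rintro ⟨_, h2⟩
          exact h2
        · intro h2
          exact ⟨hs.1.trans (h2 ▸ inf_le_left), h2⟩
      · intro h
        simp [hpt] at h
    · intro y hy
      simp only [Finset.mem_filter, Finset.mem_univ, true_and, Finset.coe_filter] at hy ⊢
      exact ⟨le_inf hy hpt, inf_le_right⟩

/-- transposition -/
theorem mob_transpose {m : α → α → ℝ} (hm : Mob m) {x p h : α} (hx : h ⊓ p = x) :
    ∀ y, x ≤ y → y ≤ h → m x y = m p (y ⊔ p) := by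
  have hxp : x ≤ p := hx ▸ inf_le_right
  intro y
  induction y using WellFoundedLT.induction with
  | ind y ih =>
    intro hxy hyh
    have key : ∀ z, x ≤ z → z ≤ h → h ⊓ (z ⊔ p) = z := by
      intro z h1 h2
      rw [inf_comm, sup_inf_assoc_of_le p h2, inf_comm, hx]
      exact sup_eq_left.mpr h1
    rcases eq_or_lt_of_le hxy with rfl | hlt
    · rw [hm.1, sup_eq_right.mpr hxp, hm.1]
    · have e1 := hm.2 x y hlt
      have hlt' : p < y ⊔ p := by
        refine lt_of_le_of_ne le_sup_right (fun he => ?_)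
        have := key y hxy hyh
        rw [← he, hx] at this
        exact hlt.ne this
      have e2 := hm.2 p _ hlt'
      have e3 : ∑ z ∈ Finset.univ.filter (fun z => x ≤ z ∧ z ≤ y), m p (z ⊔ p) =
          ∑ z ∈ Finset.univ.filter (fun z => p ≤ z ∧ z ≤ y ⊔ p), m p z := by
        apply Finset.sum_bij' (fun z _ => z ⊔ p) (fun w _ => h ⊓ w)
        · intro z hz
          simp only [Finset.mem_filter, Finset.mem_univ, true_and] at hz ⊢
          exact ⟨le_sup_right, sup_le_sup_right hz.2 _⟩
        · intro w hw
          simp only [Finset.mem_filter, Finset.mem_univ, true_and] at hw ⊢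
          refine ⟨hx ▸ inf_le_inf_left _ hw.1, ?_⟩
          rw [← key y hxy hyh]
          exact inf_le_inf_left _ hw.2
        · intro z hz
          simp only [Finset.mem_filter, Finset.mem_univ, true_and] at hz
          exact key z hz.1 (hz.2.trans hyh)
        · intro w hw
          simp only [Finset.mem_filter, Finset.mem_univ, true_and] at hw
          rw [inf_comm, inf_sup_assoc_of_le h hw.1]
          exact inf_eq_left.mpr (hw.2.trans (sup_le_sup_right hyh _))
        · intros; rfl
      rw [← e3] at e2
      have hy : y ∈ Finset.univ.filter (fun z => x ≤ z ∧ z ≤ y) := by simp [hxy]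
      rw [← Finset.add_sum_erase _ _ hy] at e1 e2
      have e4 : ∑ z ∈ (Finset.univ.filter (fun z => x ≤ z ∧ z ≤ y)).erase y, m x z =
        ∑ z ∈ (Finset.univ.filter (fun z => x ≤ z ∧ z ≤ y)).erase y, m p (z ⊔ p) := by
        apply Finset.sum_congr rfl
        intro z hz
        simp only [Finset.mem_erase, Finset.mem_filter, Finset.mem_univ, true_and] at hz
        exact ih z (lt_of_le_of_ne hz.2.2 hz.1) hz.2.1 (hz.2.2.trans hyh)
      linarith

/-- complemented interval `[x, ⊤]` -/
def Sm (x : α) : Prop := ∀ y, x ≤ y → ∃ z, x ≤ z ∧ y ⊔ z = ⊤ ∧ y ⊓ z = x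

/-- `x` is the meet of the coatoms above it -/
def Qm (x : α) : Prop := ∀ y, ¬ y ≤ x → ∃ h, IsCoatom h ∧ x ≤ h ∧ ¬ y ≤ h

theorem Sm.qm {x : α} (h : Sm x) : Qm x := by
  intro y hy
  obtain ⟨z, h1, h2, h3⟩ := h (y ⊔ x) le_sup_right
  have hz : z ≠ ⊤ := by
    rintro rfl
    rw [inf_top_eq] at h3
    exact hy (h3 ▸ le_sup_left)
  obtain ⟨c, hc, hzc⟩ := (eq_top_or_exists_le_coatom z).resolve_left hz
  refine ⟨c, hc, h1.trans hzc, fun hyc => hc.1 ?_⟩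
  rw [← top_le_iff, ← h2]
  exact sup_le (sup_le hyc (h1.trans hzc)) hzc

theorem coatom_sup {h y : α} (hh : IsCoatom h) (hy : ¬ y ≤ h) : y ⊔ h = ⊤ := by
  apply hh.2
  refine lt_of_le_of_ne le_sup_right (fun he => hy (he ▸ le_sup_left))

theorem Qm.sm {x : α} (hq : Qm x) : Sm x := by
  intro y hy
  obtain ⟨z, hz⟩ := (Set.toFinite {z | x ≤ z ∧ y ⊔ z = ⊤}).exists_minimal
    ⟨⊤, le_top, by simp⟩
  obtain ⟨⟨hz1, hz2⟩, hz3⟩ := hz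
  refine ⟨z, hz1, hz2, ?_⟩
  by_contra hne
  have : ¬ y ⊓ z ≤ x := fun h => hne (le_antisymm h (le_inf hy hz1))
  obtain ⟨h, hh, hxh, hyz⟩ := hq _ this
  have h1 : y ⊔ (z ⊓ h) = ⊤ := by
    rw [← top_le_iff, ← hz2]
    refine sup_le le_sup_left ?_
    have : z = (y ⊓ z) ⊔ (z ⊓ h) := by
      rw [inf_comm z h, ← sup_inf_assoc_of_le h inf_le_right, coatom_sup hh hyz]
      simp
    calc z = (y ⊓ z) ⊔ (z ⊓ h) := this
      _ ≤ _ := sup_le_sup_right inf_le_left _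
  have h2 := hz3 (y := z ⊓ h) ⟨le_inf hz1 hxh, h1⟩ inf_le_left
  exact hyz (inf_le_right.trans (h2.trans inf_le_right))

theorem Qm.inf {x y : α} (hx : Qm x) (hy : Qm y) : Qm (x ⊓ y) := by
  intro m hm
  by_cases h : m ≤ x
  · obtain ⟨c, h1, h2, h3⟩ := hy m (fun h' => hm (le_inf h h'))
    exact ⟨c, h1, inf_le_right.trans h2, h3⟩
  · obtain ⟨c, h1, h2, h3⟩ := hx m h
    exact ⟨c, h1, inf_le_left.trans h2, h3⟩

/-- Hall -/
theorem qm_of_mob {m : α → α → ℝ} (hm : Mob m) {x : α} (hx : m x ⊤ ≠ 0) : Qm x := by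
  intro y hy
  by_contra hcon
  push Not at hcon
  have hlt : x < y ⊔ x := lt_of_le_of_ne le_sup_right (fun h => hy (h ▸ le_sup_left))
  have h := weisner hm hlt ⊤ le_top
  have : Finset.univ.filter (fun z => x ≤ z ∧ z ⊔ (y ⊔ x) = ⊤) = {⊤} := by
    ext z
    simp only [Finset.mem_filter, Finset.mem_univ, true_and, Finset.mem_singleton]
    constructor
    · rintro ⟨h1, h2⟩
      by_contra hz
      obtain ⟨c, hc, hzc⟩ := (eq_top_or_exists_le_coatom z).resolve_left hz
      have := hcon c hc (h1.trans hzc)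
      apply hc.1
      rw [← top_le_iff, ← h2]
      exact sup_le hzc (sup_le this (h1.trans hzc))
    · rintro rfl
      simp
  rw [this, Finset.sum_singleton] at h
  exact hx h

theorem Sm.mono {x y : α} (h : Sm x) (hxy : x ≤ y) : Sm y := by
  intro w hw
  obtain ⟨z, h1, h2, h3⟩ := h w (hxy.trans hw)
  refine ⟨z ⊔ y, le_sup_right, ?_, ?_⟩
  · rw [← sup_assoc, h2]; simp
  · rw [inf_comm, sup_comm, sup_inf_assoc_of_le z hw, inf_comm, h3]
    exact sup_eq_left.mpr hxy

end
end MomentLat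


namespace MomentLat

set_option linter.unusedSectionVars false
set_option linter.unusedSimpArgs false

section
variable {α : Type*} [Lattice α] [IsModularLattice α] [OrderTop α] [Fintype α]

theorem atom_inf {x a y : α} (ha : x ⋖ a) (hy : x ≤ y) (h : ¬ a ≤ y) : a ⊓ y = x := by
  rcases ha.eq_or_eq (le_inf ha.le hy) inf_le_left with h1 | h1
  · exact h1
  · exact absurd (inf_eq_left.mp h1) h

theorem atom_cov {x a y : α} (ha : x ⋖ a) (hy : x ≤ y) (h : ¬ a ≤ y) : y ⋖ a ⊔ y := by
  apply covBy_sup_of_inf_covBy_left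
  rw [atom_inf ha hy h]
  exact ha

theorem atom_le {x a b : α} (ha : x ⋖ a) (hb : x ⋖ b) (h : a ≤ b) : a = b := by
  rcases hb.eq_or_eq ha.le h with h1 | h1
  · exact absurd h1 ha.lt.ne'
  · exact h1

theorem atomistic {x y z : α} (h : Sm x) (hy : x ≤ y) (hz : x ≤ z)
    (H : ∀ a, x ⋖ a → a ≤ y → a ≤ z) : y ≤ z := by
  by_contra hyz
  obtain ⟨w, h1, h2, h3⟩ := h (y ⊓ z) (le_inf hy hz)
  have h4 : (y ⊓ z) ⊔ (w ⊓ y) = y := by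
    rw [← sup_inf_assoc_of_le w inf_le_left, h2]; simp
  have h5 : x < w ⊓ y := by
    refine lt_of_le_of_ne (le_inf h1 hy) (fun he => hyz ?_)
    rw [← he, sup_eq_left.mpr (le_inf hy hz)] at h4
    exact inf_eq_left.mp h4
  obtain ⟨a, ha, hau⟩ := exists_covBy_le_of_lt h5
  have hay : a ≤ y := hau.trans inf_le_right
  have : a ≤ x := h3 ▸ le_inf (le_inf hay (H a ha hay)) (hau.trans inf_le_left)
  exact absurd this ha.lt.not_ge

theorem exch {x a b c : α} (ha : x ⋖ a) (hb : x ⋖ b) (hc : x ⋖ c) (h : c ≤ a ⊔ b) (hne : c ≠ a) :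
    a ⊔ c = a ⊔ b := by
  have hab : ¬ b ≤ a := by
    intro hba
    rw [sup_eq_left.mpr hba] at h
    exact hne (atom_le hc ha h)
  have h1 : a ⋖ a ⊔ b := by
    rw [sup_comm]; exact atom_cov hb ha.le hab
  rcases h1.eq_or_eq (le_sup_left : a ≤ a ⊔ c) (sup_le le_sup_left h) with h2 | h2
  · exact absurd (atom_le hc ha (h2 ▸ le_sup_right)) hne
  · exact h2

theorem proj {x z w c : α} (h : Sm x) (hz : x ≤ z) (hw : x ≤ w) (hc : x ⋖ c) (hcz : c ≤ z ⊔ w)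
    (hz' : ¬ c ≤ z) (hw' : ¬ c ≤ w) :
    ∃ a b, x ⋖ a ∧ a ≤ z ∧ x ⋖ b ∧ b ≤ w ∧ ¬ b ≤ z ∧ c ≤ a ⊔ b := by
  have h1 : z ⊔ (w ⊓ (z ⊔ c)) = z ⊔ c := by
    rw [← sup_inf_assoc_of_le w le_sup_left]
    exact inf_eq_right.mpr (sup_le le_sup_left hcz)
  have h2 : ¬ (w ⊓ (z ⊔ c)) ≤ z := by
    intro h2
    rw [sup_eq_left.mpr h2] at h1
    exact hz' (h1 ▸ le_sup_right)
  have h3 : ∃ b, x ⋖ b ∧ b ≤ w ⊓ (z ⊔ c) ∧ ¬ b ≤ z := by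
    by_contra hcon
    push Not at hcon
    exact h2 (atomistic h (le_inf hw (hz.trans le_sup_left)) hz hcon)
  obtain ⟨b, hb, hbw, hbz⟩ := h3
  have hbw' := hbw.trans inf_le_left
  have hcb : ¬ c ≤ b := fun hcb => hw' (hcb.trans hbw')
  have hcov : z ⋖ z ⊔ (c ⊔ b) := by
    have : z ⊔ (c ⊔ b) = c ⊔ z := by
      apply le_antisymm
      · exact sup_le le_sup_right (sup_le le_sup_left ((hbw.trans inf_le_right).trans
          (sup_comm z c).le))
      · exact sup_le (le_sup_left.trans le_sup_right) le_sup_left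
    rw [this]
    exact atom_cov hc hz hz'
  have hacov : z ⊓ (c ⊔ b) ⋖ c ⊔ b := inf_covBy_of_covBy_sup_left hcov
  have hbcov : b ⋖ c ⊔ b := atom_cov hc hb.le hcb
  have hxa : x ≤ z ⊓ (c ⊔ b) := le_inf hz (hb.le.trans le_sup_right)
  have hba : ¬ b ≤ z ⊓ (c ⊔ b) := fun h => hbz (h.trans inf_le_left)
  have hsup : (z ⊓ (c ⊔ b)) ⊔ b = c ⊔ b := by
    rcases hacov.eq_or_eq (le_sup_left : _ ≤ (z ⊓ (c ⊔ b)) ⊔ b)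
      (sup_le inf_le_right le_sup_right) with h4 | h4
    · exact absurd (h4 ▸ le_sup_right) hba
    · exact h4
  refine ⟨z ⊓ (c ⊔ b), b, ?_, inf_le_left, hb, hbw', hbz, le_sup_left.trans hsup.ge⟩
  have h5 : b ⊓ (z ⊓ (c ⊔ b)) = x := atom_inf hb hxa hba
  have h6 := inf_covBy_of_covBy_sup_left (a := b) (b := z ⊓ (c ⊔ b))
    (by rw [sup_comm, hsup]; exact hbcov)
  rwa [h5] at h6

/-- distributive elements of `[x, ⊤]` -/
def Dist (x z : α) : Prop :=
  x ≤ z ∧ ∀ K₁ K₂ : α, x ≤ K₁ → x ≤ K₂ → z ⊔ (K₁ ⊓ K₂) = (z ⊔ K₁) ⊓ (z ⊔ K₂)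

def Dz (x z : α) : Prop :=
  x ≤ z ∧ ∀ a b c : α, x ⋖ a → a ≤ z → x ⋖ b → ¬ b ≤ z → x ⋖ c → c ≤ a ⊔ b → c = a ∨ c = b

theorem Dist.dz {x z : α} (h : Dist x z) : Dz x z := by
  refine ⟨h.1, fun a b c ha haz hb hbz hc hcab => ?_⟩
  by_contra hcon
  push Not at hcon
  have h1 := exch ha hb hc hcab hcon.1
  have h2 := h.2 b c hb.le hc.le
  have hbc : ¬ b ≤ c := fun h => hcon.2 (atom_le hb hc h).symm
  rw [atom_inf hb hc.le hbc, sup_eq_left.mpr h.1] at h2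
  apply hbz
  rw [h2]
  refine le_inf le_sup_right ?_
  calc b ≤ a ⊔ b := le_sup_right
    _ = a ⊔ c := h1.symm
    _ ≤ z ⊔ c := sup_le_sup_right haz _

theorem Dz.dist {x z : α} (hs : Sm x) (h : Dz x z) : Dist x z := by
  refine ⟨h.1, fun K₁ K₂ h1 h2 => le_antisymm ?_ ?_⟩
  · exact le_inf (sup_le_sup_left inf_le_left _) (sup_le_sup_left inf_le_right _)
  · have key : ∀ c K, x ⋖ c → x ≤ K → c ≤ z ⊔ K → ¬ c ≤ z → c ≤ K := by
      intro c K hc hK hcK hcz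
      by_contra hcK'
      obtain ⟨a, b, ha, haz, hb, hbK, hbz, hcab⟩ := proj hs h.1 hK hc hcK hcz hcK'
      rcases h.2 a b c ha haz hb hbz hc hcab with rfl | rfl
      · exact hcz haz
      · exact hcK' hbK
    apply atomistic hs (le_inf (h.1.trans le_sup_left) (h.1.trans le_sup_left))
      (h.1.trans le_sup_left)
    intro c hc hcle
    by_cases hcz : c ≤ z
    · exact hcz.trans le_sup_left
    · exact (le_inf (key c K₁ hc h1 (hcle.trans inf_le_left) hcz)
        (key c K₂ hc h2 (hcle.trans inf_le_right) hcz)).trans le_sup_right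

theorem Dz.compl {x z : α} (hs : Sm x) (h : Dz x z) :
    ∃ z', Dz x z' ∧ ∀ a, x ⋖ a → (a ≤ z' ↔ ¬ a ≤ z) := by
  obtain ⟨z', h1, h2, h3⟩ := hs z h.1
  have key : ∀ a, x ⋖ a → (a ≤ z' ↔ ¬ a ≤ z) := by
    intro a ha
    constructor
    · intro h4 h5
      exact absurd (h3 ▸ le_inf h5 h4 : a ≤ x) ha.lt.not_ge
    · intro h4
      by_contra h5
      obtain ⟨u, v, hu, huz, hv, hvz, hvz', hle⟩ := proj hs h.1 h1 ha (h2 ▸ le_top) h4 h5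
      rcases h.2 u v a hu huz hv hvz' ha hle with rfl | rfl
      · exact h4 huz
      · exact h5 hvz
  refine ⟨z', ⟨h1, ?_⟩, key⟩
  intro a b c ha haz hb hbz hc hcab
  have hb' : b ≤ z := by
    by_contra h'
    exact hbz ((key b hb).mpr h')
  rcases h.2 b a c hb hb' ha ((key a ha).mp haz) hc (by rwa [sup_comm]) with h5 | h5
  · exact Or.inr h5
  · exact Or.inl h5

/-- number of distributive elements -/
noncomputable def Zc (x : α) : ℕ := (Finset.univ.filter (fun z : α => Dist x z)).card

theorem Zc_half {x p : α} (hs : Sm x) (hp : x ⋖ p) :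
    2 * (Finset.univ.filter (fun z : α => Dist x z ∧ p ≤ z)).card = Zc x := by
  have hex : ∀ z : α, ∃ z' : α, Dist x z → Dist x z' ∧ ∀ a, x ⋖ a → (a ≤ z' ↔ ¬ a ≤ z) := by
    intro z
    by_cases h : Dist x z
    · obtain ⟨z', h1, h2⟩ := h.dz.compl hs
      exact ⟨z', fun _ => ⟨h1.dist hs, h2⟩⟩
    · exact ⟨z, fun h' => absurd h' h⟩
  choose st hst using hex
  have hinv : ∀ z, Dist x z → st (st z) = z := by
    intro z hz
    have h1 := hst z hz
    have h2 := hst _ h1.1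
    apply le_antisymm
    · apply atomistic hs h2.1.1 hz.1
      intro a ha h3
      by_contra h4
      exact (h2.2 a ha).mp h3 ((h1.2 a ha).mpr h4)
    · apply atomistic hs hz.1 h2.1.1
      intro a ha h3
      exact (h2.2 a ha).mpr (fun h4 => (h1.2 a ha).mp h4 h3)
  have h1 : (Finset.univ.filter (fun z : α => Dist x z ∧ p ≤ z)).card =
      (Finset.univ.filter (fun z : α => Dist x z ∧ ¬ p ≤ z)).card := by
    apply Finset.card_bij' (fun z _ => st z) (fun z _ => st z)
    · intro z hz
      simp only [Finset.mem_filter, Finset.mem_univ, true_and] at hz ⊢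
      exact ⟨(hst z hz.1).1, fun h => ((hst z hz.1).2 p hp).mp h hz.2⟩
    · intro z hz
      simp only [Finset.mem_filter, Finset.mem_univ, true_and] at hz ⊢
      exact ⟨(hst z hz.1).1, ((hst z hz.1).2 p hp).mpr hz.2⟩
    · intro z hz
      simp only [Finset.mem_filter, Finset.mem_univ, true_and] at hz
      exact hinv z hz.1
    · intro z hz
      simp only [Finset.mem_filter, Finset.mem_univ, true_and] at hz
      exact hinv z hz.1
  rw [two_mul]
  nth_rewrite 2 [h1]
  unfold Zc
  rw [← Finset.card_filter_add_card_filter_not (s := Finset.univ.filter (fun z : α => Dist x z))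
    (p := fun z => p ≤ z), Finset.filter_filter, Finset.filter_filter]

theorem K1 {x p z a b c : α} (hp : x ⋖ p) (hz : Dist p z) (ha : x ⋖ a) (haz : a ≤ z)
    (hb : x ⋖ b) (hbz : ¬ b ≤ z) (hc : x ⋖ c) (hcab : c ≤ a ⊔ b) (hpab : ¬ p ≤ a ⊔ b) :
    c = a ∨ c = b := by
  by_contra hcon
  push Not at hcon
  have h1 := exch ha hb hc hcab hcon.1
  have hbp : ¬ b ≤ p := fun h => hpab (atom_le hb hp h ▸ le_sup_right)
  have hcp : ¬ c ≤ p := fun h => hpab (atom_le hc hp h ▸ hcab)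
  have h2 := hz.2 (b ⊔ p) (c ⊔ p) le_sup_right le_sup_right
  have c1 := atom_cov hb hp.le hbp
  have c2 := atom_cov hc hp.le hcp
  have h3 : ¬ (b ⊔ p) ≤ c ⊔ p := by
    intro h3
    have h4 : b ≤ c ⊔ p := le_sup_left.trans h3
    have h5 := exch hc hp hb h4 (Ne.symm hcon.2)
    apply hpab
    calc p ≤ c ⊔ p := le_sup_right
      _ = c ⊔ b := h5.symm
      _ ≤ a ⊔ b := sup_le hcab le_sup_right
  rw [atom_inf c1 le_sup_right h3, sup_eq_left.mpr hz.1] at h2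
  apply hbz
  rw [h2]
  refine le_inf (le_sup_left.trans le_sup_right) ?_
  calc b ≤ a ⊔ b := le_sup_right
    _ = a ⊔ c := h1.symm
    _ ≤ _ := sup_le_sup haz le_sup_left

theorem K2 {x p z : α} (hp : x ⋖ p) (hz : Dist p z)
    (hl : ∀ b c, x ⋖ b → ¬ b ≤ z → x ⋖ c → c ≤ p ⊔ b → c = p ∨ c = b) : Dz x z := by
  refine ⟨hp.le.trans hz.1, ?_⟩
  intro a b c ha haz hb hbz hc hcab
  by_cases hpab : p ≤ a ⊔ b
  · by_cases hpa : p = a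
    · subst hpa
      exact hl b c hb hbz hc hcab
    · have h1 := exch ha hb hp hpab hpa
      exact absurd ((h1 ▸ le_sup_right : b ≤ a ⊔ p).trans (sup_le haz hz.1)) hbz
  · exact K1 hp hz ha haz hb hbz hc hcab hpab

theorem K3 {x p z r s : α} (hp : x ⋖ p) (hz : Dist p z) (hr : x ⋖ r) (hs : x ⋖ s)
    (hrp : r ≠ p) (hsp : s ≠ p) (hrs : r ≠ s) (hsl : s ≤ p ⊔ r) (hrz : r ≤ z) : Dz x z := by
  apply K2 hp hz
  intro b c hb hbz hc hcpb
  by_contra hcon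
  push Not at hcon
  have hpz := hz.1
  have hsz : s ≤ z := hsl.trans (sup_le hpz hrz)
  have e1 := exch hp hb hc hcpb hcon.1
  have hcz : ¬ c ≤ z := fun h => hbz ((e1 ▸ le_sup_right : b ≤ p ⊔ c).trans (sup_le hpz h))
  have hprb : ¬ p ≤ r ⊔ b := by
    intro h
    have := exch hr hb hp h (Ne.symm hrp)
    exact hbz ((this ▸ le_sup_right : b ≤ r ⊔ p).trans (sup_le hrz hpz))
  have hsrb : ¬ s ≤ r ⊔ b := by
    intro h
    have := exch hr hb hs h (Ne.symm hrs)
    exact hbz ((this ▸ le_sup_right : b ≤ r ⊔ s).trans (sup_le hrz hsz))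
  have cov1 : r ⊔ b ⋖ p ⊔ (r ⊔ b) := atom_cov hp (hr.le.trans le_sup_left) hprb
  have e2 : (r ⊔ b) ⊔ (s ⊔ c) = p ⊔ (r ⊔ b) := by
    have hle : (r ⊔ b) ⊔ (s ⊔ c) ≤ p ⊔ (r ⊔ b) := by
      refine sup_le le_sup_right (sup_le (hsl.trans ?_) (hcpb.trans ?_))
      · exact sup_le_sup_left le_sup_left _
      · exact sup_le_sup_left le_sup_right _
    rcases cov1.eq_or_eq (le_sup_left : r ⊔ b ≤ (r ⊔ b) ⊔ (s ⊔ c)) hle with h | h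
    · exact absurd (le_sup_left.trans (h ▸ le_sup_right : s ⊔ c ≤ r ⊔ b)) hsrb
    · exact h
  have cov2 : (r ⊔ b) ⊓ (s ⊔ c) ⋖ s ⊔ c :=
    inf_covBy_of_covBy_sup_left (by rw [e2]; exact cov1)
  have hcs : ¬ c ≤ s := fun h => hcz (h.trans hsz)
  have cov3 : s ⋖ c ⊔ s := atom_cov hc hs.le hcs
  have hxlt : x < (r ⊔ b) ⊓ (s ⊔ c) := by
    refine lt_of_le_of_ne (le_inf (hr.le.trans le_sup_left) (hs.le.trans le_sup_left)) ?_
    intro he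
    rw [← he] at cov2
    exact cov2.2 hs.lt (by rw [sup_comm]; exact cov3.lt)
  obtain ⟨t, ht, htle⟩ := exists_covBy_le_of_lt hxlt
  have ht2 : t ≤ s ⊔ c := htle.trans inf_le_right
  rcases K1 hp hz hr hrz hb hbz ht (htle.trans inf_le_left) hprb with rfl | rfl
  · have := exch hs hc ht ht2 hrs
    exact hcz ((this ▸ le_sup_right : c ≤ s ⊔ t).trans (sup_le hsz hrz))
  · have h1 := exch hc hs ht (by rwa [sup_comm]) (Ne.symm hcon.2)
    have h2 : s ≤ p ⊔ t := (h1 ▸ le_sup_right : s ≤ c ⊔ t).trans (sup_le hcpb le_sup_right)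
    have h3 := exch hp ht hs h2 hsp
    exact hbz ((h3 ▸ le_sup_right : t ≤ p ⊔ s).trans (sup_le hpz hsz))

end
end MomentLat


namespace MomentLat

set_option linter.unusedSectionVars false
set_option linter.unusedSimpArgs false

section
variable {α : Type*} [Lattice α] [IsModularLattice α] [OrderTop α] [Fintype α]

/-- coatoms above `x` and not above `p` -/
noncomputable def cof (x p : α) : Finset α :=
  Finset.univ.filter (fun h => IsCoatom h ∧ x ≤ h ∧ ¬ p ≤ h)

theorem mem_cof {x p h : α} : h ∈ cof x p ↔ IsCoatom h ∧ x ≤ h ∧ ¬ p ≤ h := by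
  simp [cof]

theorem g_rec {m : α → α → ℝ} (hm : Mob m) {x p : α} (hp : x ⋖ p) :
    m x ⊤ = -((cof x p).card : ℝ) * m p ⊤ := by
  have h0 := weisner hm hp.lt ⊤ le_top
  have hset : Finset.univ.filter (fun y => x ≤ y ∧ y ⊔ p = ⊤) = insert ⊤ (cof x p) := by
    ext y
    simp only [Finset.mem_filter, Finset.mem_univ, true_and, Finset.mem_insert, mem_cof]
    constructor
    · rintro ⟨h1, h2⟩
      by_cases hpy : p ≤ y
      · left; rwa [sup_eq_left.mpr hpy] at h2
      · right
        have := atom_cov hp h1 hpy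
        rw [sup_comm, h2] at this
        exact ⟨covBy_top_iff.mp this, h1, hpy⟩
    · rintro (rfl | ⟨h1, h2, h3⟩)
      · simp
      · refine ⟨h2, ?_⟩
        rw [sup_comm]; exact coatom_sup h1 h3
  rw [hset, Finset.sum_insert (by simp [mem_cof])] at h0
  have h1 : ∑ y ∈ cof x p, m x y = ∑ y ∈ cof x p, m p ⊤ := by
    apply Finset.sum_congr rfl
    intro h hh
    rw [mem_cof] at hh
    have h2 : h ⊓ p = x := by rw [inf_comm]; exact atom_inf hp hh.2.1 hh.2.2
    rw [mob_transpose hm h2 h hh.2.1 le_rfl, sup_comm, coatom_sup hh.1 hh.2.2]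
  rw [h1, Finset.sum_const, nsmul_eq_mul] at h0
  linarith

noncomputable def Fs (m : α → α → ℝ) (x : α) : ℝ :=
  ∑ y ∈ Finset.univ.filter (fun y => x ≤ y), |m y ⊤|

theorem f_rec {m : α → α → ℝ} (hm : Mob m) {x p : α} (hp : x ⋖ p) :
    Fs m x = (1 + ((cof x p).card : ℝ)) * Fs m p := by
  unfold Fs
  rw [← Finset.sum_filter_add_sum_filter_not (s := Finset.univ.filter (fun y => x ≤ y))
    (p := fun y => p ≤ y), Finset.filter_filter, Finset.filter_filter, add_mul, one_mul]
  congr 1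
  · apply Finset.sum_congr _ (fun _ _ => rfl)
    ext y
    simp only [Finset.mem_filter, Finset.mem_univ, true_and]
    exact ⟨fun h => h.2, fun h => ⟨hp.le.trans h, h⟩⟩
  · have h1 : ∑ y ∈ Finset.univ.filter (fun y => x ≤ y ∧ ¬ p ≤ y), |m y ⊤| =
        ∑ y ∈ Finset.univ.filter (fun y => x ≤ y ∧ ¬ p ≤ y),
          ∑ h ∈ (cof x p).filter (fun h => y ≤ h), |m (y ⊔ p) ⊤| := by
      apply Finset.sum_congr rfl
      intro y hy
      simp only [Finset.mem_filter, Finset.mem_univ, true_and] at hy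
      have hc := atom_cov hp hy.1 hy.2
      rw [sup_comm] at hc
      rw [g_rec hm hc, Finset.sum_const, nsmul_eq_mul, abs_mul, abs_neg, Nat.abs_cast]
      congr 3
      ext h
      simp only [mem_cof, Finset.mem_filter]
      constructor
      · rintro ⟨h1, h2, h3⟩
        exact ⟨⟨h1, hy.1.trans h2, fun h => h3 (sup_le h2 h)⟩, h2⟩
      · rintro ⟨⟨h1, h2, h3⟩, h4⟩
        exact ⟨h1, h4, fun h => h3 (le_sup_right.trans h)⟩
    rw [h1]
    rw [Finset.sum_comm' (t' := cof x p)
      (s' := fun h => Finset.univ.filter (fun y => x ≤ y ∧ y ≤ h))]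
    · rw [← nsmul_eq_mul, ← Finset.sum_const]
      apply Finset.sum_congr rfl
      intro h hh
      rw [mem_cof] at hh
      have hx : p ⊓ h = x := atom_inf hp hh.2.1 hh.2.2
      have ht : p ⊔ h = ⊤ := coatom_sup hh.1 hh.2.2
      apply Finset.sum_bij' (fun z _ => z ⊔ p) (fun w _ => w ⊓ h)
      · intro z hz
        simp only [Finset.mem_filter, Finset.mem_univ, true_and] at hz ⊢
        exact le_sup_right
      · intro w hw
        simp only [Finset.mem_filter, Finset.mem_univ, true_and] at hw ⊢
        exact ⟨le_inf (hp.le.trans hw) hh.2.1, inf_le_right⟩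
      · intro z hz
        simp only [Finset.mem_filter, Finset.mem_univ, true_and] at hz
        rw [sup_inf_assoc_of_le p hz.2, hx]
        exact sup_eq_left.mpr hz.1
      · intro w hw
        simp only [Finset.mem_filter, Finset.mem_univ, true_and] at hw
        rw [inf_sup_assoc_of_le h hw, sup_comm, ht]
        simp
      · intros; rfl
    · intro y h
      simp only [mem_cof, Finset.mem_filter, Finset.mem_univ, true_and]
      constructor
      · rintro ⟨⟨h1, h2⟩, h3, h4⟩
        exact ⟨⟨h1, h4⟩, h3⟩
      · rintro ⟨⟨h1, h2⟩, h3⟩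
        exact ⟨⟨h1, fun h => h3.2.2 (h.trans h2)⟩, h3, h2⟩

theorem cof_pos {x p : α} (hs : Sm x) (hp : x ⋖ p) : 1 ≤ (cof x p).card := by
  obtain ⟨h, h1, h2, h3⟩ := hs.qm p hp.lt.not_ge
  exact Finset.card_pos.mpr ⟨h, mem_cof.mpr ⟨h1, h2, h3⟩⟩

theorem g_ne {m : α → α → ℝ} (hm : Mob m) : ∀ x : α, Sm x → m x ⊤ ≠ 0 := by
  intro x
  induction x using WellFoundedGT.induction with
  | ind x ih =>
    intro hs
    rcases eq_or_lt_of_le (le_top : x ≤ ⊤) with rfl | hlt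
    · rw [hm.1]; exact one_ne_zero
    · obtain ⟨p, hp, -⟩ := exists_covBy_le_of_lt hlt
      rw [g_rec hm hp]
      have h1 := ih p hp.lt (hs.mono hp.le)
      have h2 := cof_pos hs hp
      have h3 : ((cof x p).card : ℝ) ≠ 0 := by positivity
      exact mul_ne_zero (neg_ne_zero.mpr h3) h1

theorem cof_two {m : α → α → ℝ} (hm : Mob m) {x p r s : α} (hS : Sm x)
    (hp : x ⋖ p) (hr : x ⋖ r) (hs : x ⋖ s)
    (hrp : r ≠ p) (hsp : s ≠ p) (hrs : r ≠ s) (hsl : s ≤ p ⊔ r) :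
    2 * (cof p (p ⊔ r)).card ≤ (cof x p).card := by
  set l := p ⊔ r with hl
  have hpr : p ⊔ r = l := rfl
  have hps : p ⊔ s = l := exch hp hr hs hsl hsp
  have hrs' : r ⊔ s = l := by
    have := exch hr hp hs (by rwa [sup_comm]) (Ne.symm hrs)
    rw [this, sup_comm]
  have cov : ∀ a b, x ⋖ a → x ⋖ b → a ≠ b → a ⋖ a ⊔ b := by
    intro a b ha hb hab
    rw [sup_comm]
    exact atom_cov hb ha.le (fun h => hab (atom_le hb ha h).symm)
  have cp : p ⋖ l := cov p r hp hr hrp.symm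
  have cr : r ⋖ l := hrs' ▸ cov r s hr hs hrs
  have cs : s ⋖ l := by
    have := cov s p hs hp hsp
    rwa [sup_comm, hps] at this
  have gl := g_ne hm l (hS.mono (hp.le.trans cp.le))
  have prod : ∀ a, x ⋖ a → a ⋖ l →
      (cof x a).card * (cof a l).card * m l ⊤ = m x ⊤ := by
    intro a ha hal
    rw [g_rec hm ha, g_rec hm hal]; ring
  have tot : ∀ a, x ⋖ a → a ⋖ l → (cof x a).card + (cof a l).card = (cof x l).card := by
    intro a ha hal
    rw [← Finset.card_union_of_disjoint]
    · congr 1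
      ext h
      simp only [Finset.mem_union, mem_cof]
      constructor
      · rintro (⟨h1, h2, h3⟩ | ⟨h1, h2, h3⟩)
        · exact ⟨h1, h2, fun h => h3 (hal.le.trans h)⟩
        · exact ⟨h1, ha.le.trans h2, h3⟩
      · rintro ⟨h1, h2, h3⟩
        by_cases h4 : a ≤ h
        · exact Or.inr ⟨h1, h4, h3⟩
        · exact Or.inl ⟨h1, h2, h4⟩
    · rw [Finset.disjoint_left]
      intro h h1 h2
      rw [mem_cof] at h1 h2
      exact h1.2.2 h2.2.1
  have sub : (cof r l).card + (cof s l).card ≤ (cof x p).card := by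
    rw [← Finset.card_union_of_disjoint]
    · apply Finset.card_le_card
      intro h
      simp only [Finset.mem_union, mem_cof]
      rintro (⟨h1, h2, h3⟩ | ⟨h1, h2, h3⟩)
      · exact ⟨h1, hr.le.trans h2, fun h => h3 (sup_le h h2)⟩
      · exact ⟨h1, hs.le.trans h2, fun h => h3 (hps ▸ sup_le h h2)⟩
    · rw [Finset.disjoint_left]
      intro h h1 h2
      rw [mem_cof] at h1 h2
      exact h1.2.2 (hrs' ▸ sup_le h1.2.1 h2.2.1)
  have pp := prod p hp cp
  have pr := prod r hr cr
  have ps := prod s hs cs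
  have tp := tot p hp cp
  have tr := tot r hr cr
  have ts := tot s hs cs
  have np := cof_pos (hS.mono hp.le) cp
  have nr := cof_pos (hS.mono hr.le) cr
  have ns := cof_pos (hS.mono hs.le) cs
  have e1 : (cof x p).card * (cof p l).card = (cof x r).card * (cof r l).card := by
    have := mul_right_cancel₀ gl (pp.trans pr.symm)
    exact_mod_cast this
  have e2 : (cof x p).card * (cof p l).card = (cof x s).card * (cof s l).card := by
    have := mul_right_cancel₀ gl (pp.trans ps.symm)
    exact_mod_cast this
  generalize (cof x p).card = Np at *
  generalize (cof x r).card = Nr at *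
  generalize (cof x s).card = Ns at *
  generalize (cof x l).card = T at *
  generalize (cof p l).card = a at *
  generalize (cof r l).card = b at *
  generalize (cof s l).card = c at *
  have hab : a = b := by
    zify at *
    have h1 : ((a : ℤ) - b) * (T - a - b) = 0 := by
      have : (Np : ℤ) = T - a := by linarith
      have h' : (Nr : ℤ) = T - b := by linarith
      rw [this, h'] at e1
      linear_combination e1
    rcases mul_eq_zero.mp h1 with h | h
    · linarith
    · exfalso; linarith
  have hac : a = c := by
    zify at *
    have h1 : ((a : ℤ) - c) * (T - a - c) = 0 := by
      have : (Np : ℤ) = T - a := by linarith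
      have h' : (Ns : ℤ) = T - c := by linarith
      rw [this, h'] at e2
      linear_combination e2
    rcases mul_eq_zero.mp h1 with h | h
    · linarith
    · exfalso; linarith
  omega

theorem Zc_pos (x : α) : 1 ≤ Zc x := by
  apply Finset.card_pos.mpr
  refine ⟨⊤, ?_⟩
  simp only [Finset.mem_filter, Finset.mem_univ, true_and]
  exact ⟨le_top, fun _ _ _ _ => by simp⟩

theorem arith {F N Z g Fp n Zp gp : ℝ} (hF : F = (1 + N) * Fp) (hg : g = N * gp) (hN : 1 ≤ N)
    (hn : 1 ≤ n) (hNn : 2 * n ≤ N) (hZ : Zp ≤ Z) (hZp : 0 ≤ Zp) (hgp : 0 ≤ gp)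
    (hFp : Fp * (n + 1) ^ 2 ≤ n ^ 2 * Zp ^ 3 * gp) :
    F * (N + 1) ^ 2 ≤ N ^ 2 * Z ^ 3 * g := by
  subst hF hg
  have h1 : Zp ^ 3 ≤ Z ^ 3 := pow_le_pow_left₀ hZp hZ 3
  have h2 : Fp * (n + 1) ^ 2 ≤ n ^ 2 * (Z ^ 3 * gp) := by
    have : n ^ 2 * Zp ^ 3 * gp ≤ n ^ 2 * (Z ^ 3 * gp) := by
      rw [mul_assoc]; gcongr
    linarith
  set K := Z ^ 3 * gp with hK
  have hK0 : 0 ≤ K := mul_nonneg (pow_nonneg (hZp.trans hZ) 3) hgp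
  -- (1+N)^3 n^2 ≤ N^3 (n+1)^2
  have h3 : (1 + N) ^ 3 * n ^ 2 ≤ N ^ 3 * (n + 1) ^ 2 := by
    have e1 : 0 ≤ N - 2 * n := by linarith
    have a1 : (1 + N) ^ 3 * n ^ 2 - N ^ 3 * n ^ 2 = (1 + 3 * N + 3 * N ^ 2) * n ^ 2 := by ring
    have a2 : N ^ 3 * (n + 1) ^ 2 - N ^ 3 * n ^ 2 = N ^ 3 * (2 * n + 1) := by ring
    have b1 : N ^ 2 * (2 * n) * (2 * n + 1) ≤ N ^ 3 * (2 * n + 1) := by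
      have : N ^ 2 * (2 * n) ≤ N ^ 2 * N := by gcongr
      nlinarith
    have b2 : (1 + 3 * N + 3 * N ^ 2) * n ^ 2 ≤ N ^ 2 * (2 * n) * (2 * n + 1) := by
      have c0 : N ^ 2 * (2 * n) * (2 * n + 1) = 4 * N ^ 2 * n ^ 2 + 2 * N ^ 2 * n := by ring
      have c1 : N * n * (2 * n) ≤ N * n * N := by gcongr
      have c2 : n ^ 2 ≤ N ^ 2 * n ^ 2 := by
        have : (1:ℝ) ≤ N ^ 2 := one_le_pow₀ hN
        nlinarith [sq_nonneg n]
      nlinarith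
    linarith
  have hn2 : 0 < (n + 1) ^ 2 := by positivity
  have h4 : (1 + N) * Fp * (N + 1) ^ 2 * (n + 1) ^ 2 ≤ N ^ 2 * Z ^ 3 * (N * gp) * (n + 1) ^ 2 := by
    calc (1 + N) * Fp * (N + 1) ^ 2 * (n + 1) ^ 2
        = (1 + N) ^ 3 * (Fp * (n + 1) ^ 2) := by ring
      _ ≤ (1 + N) ^ 3 * (n ^ 2 * K) := by gcongr
      _ = ((1 + N) ^ 3 * n ^ 2) * K := by ring
      _ ≤ (N ^ 3 * (n + 1) ^ 2) * K := by gcongr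
      _ = _ := by rw [hK]; ring
  exact le_of_mul_le_mul_right h4 hn2

theorem Fs_top {m : α → α → ℝ} (hm : Mob m) : Fs m ⊤ = 1 := by
  unfold Fs
  have : Finset.univ.filter (fun y : α => ⊤ ≤ y) = {⊤} := by
    ext y; simp
  rw [this]; simp [hm.1]

theorem bound_of_strong {m : α → α → ℝ} (hm : Mob m) {x : α} (hs : Sm x)
    (h : ∀ p, x ⋖ p → Fs m x * ((cof x p).card + 1 : ℝ) ^ 2
      ≤ ((cof x p).card : ℝ) ^ 2 * (Zc x : ℝ) ^ 3 * |m x ⊤|) :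
    Fs m x ≤ (Zc x : ℝ) ^ 3 * |m x ⊤| := by
  rcases eq_or_lt_of_le (le_top : x ≤ ⊤) with rfl | hlt
  · rw [Fs_top hm, hm.1]
    have : (1:ℝ) ≤ (Zc (⊤ : α) : ℝ) := by exact_mod_cast Zc_pos _
    simpa using one_le_pow₀ this
  · obtain ⟨p, hp, -⟩ := exists_covBy_le_of_lt hlt
    have h1 := h p hp
    have h2 : (0:ℝ) < ((cof x p).card + 1 : ℝ) ^ 2 := by positivity
    refine le_of_mul_le_mul_right (h1.trans ?_) h2
    have : ((cof x p).card : ℝ) ^ 2 ≤ ((cof x p).card + 1 : ℝ) ^ 2 := by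
      gcongr; linarith
    calc ((cof x p).card : ℝ) ^ 2 * (Zc x : ℝ) ^ 3 * |m x ⊤|
        = ((cof x p).card : ℝ) ^ 2 * ((Zc x : ℝ) ^ 3 * |m x ⊤|) := by ring
      _ ≤ ((cof x p).card + 1 : ℝ) ^ 2 * ((Zc x : ℝ) ^ 3 * |m x ⊤|) := by gcongr; 
      _ = _ := by ring

theorem strong {m : α → α → ℝ} (hm : Mob m) : ∀ x : α, Sm x → ∀ p, x ⋖ p →
    Fs m x * ((cof x p).card + 1 : ℝ) ^ 2
      ≤ ((cof x p).card : ℝ) ^ 2 * (Zc x : ℝ) ^ 3 * |m x ⊤| := by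
  intro x
  induction x using WellFoundedGT.induction with
  | ind x ih =>
    intro hS p hp
    have hSp := hS.mono hp.le
    have ihp := ih p hp.lt hSp
    have hN := cof_pos hS hp
    have hg : |m x ⊤| = ((cof x p).card : ℝ) * |m p ⊤| := by
      rw [g_rec hm hp, abs_mul, abs_neg, Nat.abs_cast]
    by_cases hcen : ∀ b c, x ⋖ b → x ⋖ c → c ≤ p ⊔ b → c = p ∨ c = b
    · -- central case
      have hZ : 2 * Zc p ≤ Zc x := by
        rw [← Zc_half hS hp]
        apply Nat.mul_le_mul_left
        apply Finset.card_le_card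
        intro z
        simp only [Finset.mem_filter, Finset.mem_univ, true_and]
        intro hz
        exact ⟨(K2 hp hz (fun b c hb _ hc h => hcen b c hb hc h)).dist hS, hz.1⟩
      have hb := bound_of_strong hm hSp ihp
      have hN1 : (1:ℝ) ≤ ((cof x p).card : ℝ) := by exact_mod_cast hN
      have hZ' : (2:ℝ) * Zc p ≤ Zc x := by exact_mod_cast hZ
      rw [f_rec hm hp, hg]
      have hZ3 : (2 * (Zc p : ℝ)) ^ 3 ≤ (Zc x : ℝ) ^ 3 := by gcongr
      generalize ((cof x p).card : ℝ) = N at *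
      have hN3 : (1 + N) ^ 3 ≤ 8 * N ^ 3 := by
        have : (1 + N) ^ 3 ≤ (2 * N) ^ 3 := by gcongr; linarith
        linarith [this, (by ring : (2 * N) ^ 3 = 8 * N ^ 3)]
      calc (1 + N) * Fs m p * (N + 1) ^ 2 = (1 + N) ^ 3 * Fs m p := by ring
        _ ≤ (1 + N) ^ 3 * ((Zc p : ℝ) ^ 3 * |m p ⊤|) := by gcongr
        _ ≤ (8 * N ^ 3) * ((Zc p : ℝ) ^ 3 * |m p ⊤|) := by gcongr
        _ = N ^ 3 * ((2 * (Zc p : ℝ)) ^ 3 * |m p ⊤|) := by ring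
        _ ≤ N ^ 3 * ((Zc x : ℝ) ^ 3 * |m p ⊤|) := by gcongr
        _ = _ := by ring
    · push Not at hcen
      obtain ⟨r, s, hr, hs, hle, hsp, hsr⟩ := hcen
      have hrp : r ≠ p := by
        rintro rfl
        rw [sup_idem] at hle
        exact hsp (atom_le hs hp hle)
      have hcov : p ⋖ p ⊔ r := by
        rw [sup_comm]
        exact atom_cov hr hp.le (fun h => hrp (atom_le hr hp h))
      have h2 := cof_two hm hS hp hr hs hrp hsp (Ne.symm hsr) hle
      have hZ : Zc p ≤ Zc x := by
        rw [← Zc_half hS hp, ← Zc_half hSp hcov]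
        apply Nat.mul_le_mul_left
        apply Finset.card_le_card
        intro z
        simp only [Finset.mem_filter, Finset.mem_univ, true_and]
        intro hz
        exact ⟨(K3 hp hz.1 hr hs hrp hsp (Ne.symm hsr) hle (le_sup_right.trans hz.2)).dist hS,
          hz.1.1⟩
      refine arith (f_rec hm hp) hg (by exact_mod_cast hN)
        (by exact_mod_cast cof_pos hSp hcov) (by exact_mod_cast h2) (by exact_mod_cast hZ)
        (by positivity) (abs_nonneg _) (ihp _ hcov)

theorem bound {m : α → α → ℝ} (hm : Mob m) {x : α} (hs : Sm x) :
    Fs m x ≤ (Zc x : ℝ) ^ 3 * |m x ⊤| :=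
  bound_of_strong hm hs (strong hm x hs)

end
end MomentLat


namespace MomentLat

set_option linter.unusedSectionVars false
set_option linter.unusedSimpArgs false

section
variable {α : Type*} [Lattice α] [IsModularLattice α] [OrderTop α] [Fintype α]

/-- relative socle: the join of `z` and of all covers of `z` -/
noncomputable def soc (z : α) : α :=
  (insert z (Finset.univ.filter (fun a => z ⋖ a))).sup' (Finset.insert_nonempty _ _) id

theorem le_soc (z : α) : z ≤ soc z :=
  Finset.le_sup' (f := id) (Finset.mem_insert_self _ _)

theorem cov_le_soc {z a : α} (h : z ⋖ a) : a ≤ soc z :=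
  Finset.le_sup' (f := id) (Finset.mem_insert_of_mem (by simpa using h))

theorem soc_le {z w : α} (h : z ≤ w) (h' : ∀ a, z ⋖ a → a ≤ w) : soc z ≤ w := by
  apply Finset.sup'_le
  intro b hb
  rcases Finset.mem_insert.mp hb with rfl | hb
  · exact h
  · exact h' b (by simpa using hb)

theorem cov_le_soc' {z a c : α} (h : z ⋖ a) (hc : z ≤ c) : a ≤ soc c := by
  by_cases hac : a ≤ c
  · exact hac.trans (le_soc c)
  · exact le_sup_left.trans (cov_le_soc (atom_cov h hc hac))

theorem soc_mono {z c : α} (hc : z ≤ c) : soc z ≤ soc c :=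
  soc_le (hc.trans (le_soc c)) (fun _ h => cov_le_soc' h hc)

theorem soc_compl {c y : α} (hc : c ≤ y) (hy : y ≤ soc c) :
    ∃ t, c ≤ t ∧ t ≤ soc c ∧ y ⊔ t = soc c ∧ y ⊓ t = c := by
  obtain ⟨t, ht⟩ := (Set.toFinite {t | c ≤ t ∧ t ≤ soc c ∧ y ⊓ t = c}).exists_maximal
    ⟨c, le_rfl, le_soc c, inf_eq_right.mpr hc⟩
  obtain ⟨h1, h2, h3⟩ := ht.prop
  refine ⟨t, h1, h2, le_antisymm (sup_le hy h2) ?_, h3⟩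
  refine soc_le (hc.trans le_sup_left) (fun a ha => ?_)
  by_contra hn
  have e1 : (t ⊔ a) ⊓ (y ⊔ t) = t := by
    rw [sup_inf_assoc_of_le a (le_sup_right : t ≤ y ⊔ t), atom_inf ha (hc.trans le_sup_left) hn]
    exact sup_eq_left.mpr h1
  have e2 : y ⊓ (t ⊔ a) = c := by
    apply le_antisymm
    · have : y ⊓ (t ⊔ a) ≤ t := by
        refine le_trans ?_ e1.le
        exact le_inf inf_le_right (inf_le_left.trans le_sup_left)
      rw [← h3]
      exact le_inf inf_le_left this
    · exact le_inf hc (h1.trans le_sup_left)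
  have := ht.le_of_ge (y := t ⊔ a) ⟨h1.trans le_sup_left, sup_le h2 (cov_le_soc ha), e2⟩
    le_sup_left
  exact hn ((le_sup_right.trans this).trans le_sup_right)

theorem sm_of_soc {c : α} (h : soc c = ⊤) : Sm c := by
  intro y hy
  obtain ⟨t, h1, -, h3, h4⟩ := soc_compl hy (h ▸ le_top)
  exact ⟨t, h1, h ▸ h3, h4⟩

theorem exists_cov {x y : α} (h : x < y) : ∃ a, x ⋖ a ∧ a ≤ y := exists_covBy_le_of_lt h

theorem soc_atomistic {c y z : α} (hc : c ≤ y) (hy : y ≤ soc c) (hz : c ≤ z)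
    (H : ∀ a, c ⋖ a → a ≤ y → a ≤ z) : y ≤ z := by
  obtain ⟨t, h1, h2, h3, h4⟩ := soc_compl (le_inf hc hz) (inf_le_left.trans hy)
  have e : y = (y ⊓ z) ⊔ (t ⊓ y) := by
    rw [← sup_inf_assoc_of_le t (inf_le_left : y ⊓ z ≤ y), h3]
    exact (inf_eq_right.mpr hy).symm
  have e' : t ⊓ y = c := by
    by_contra hne
    obtain ⟨a, ha, hay⟩ := exists_cov (lt_of_le_of_ne (le_inf h1 hc) (Ne.symm hne))
    have h5 : a ≤ y := hay.trans inf_le_right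
    have h6 : a ≤ c := by
      rw [← h4]
      exact le_inf (le_inf h5 (H a ha h5)) (hay.trans inf_le_left)
    exact ha.lt.not_ge h6
  rw [e, e']
  exact sup_le inf_le_right hz

/-- iterated socle -/
noncomputable def cI (i : ℕ) (x : α) : α := soc^[i] x

theorem cI_zero (x : α) : cI 0 x = x := rfl
theorem cI_succ (i : ℕ) (x : α) : cI (i + 1) x = soc (cI i x) := Function.iterate_succ_apply' _ _ _

theorem le_cI (i : ℕ) (x : α) : x ≤ cI i x := by
  induction i with
  | zero => exact le_rfl
  | succ i ih => rw [cI_succ]; exact ih.trans (le_soc _)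

theorem cI_top_succ {i : ℕ} {x : α} (h : cI i x = ⊤) : cI (i + 1) x = ⊤ := by
  rw [cI_succ, h]
  exact top_le_iff.mp (le_soc _)

theorem cI_complexity (k : ℕ) (d : ℕ → α) (x : α) (h0 : d 0 ≤ x)
    (h1 : ∀ i < k, d i ≤ d (i + 1))
    (h2 : ∀ i < k, ∀ X, d i ≤ X → X ≤ d (i + 1) →
      ∃ Y, d i ≤ Y ∧ Y ≤ d (i + 1) ∧ X ⊔ Y = d (i + 1) ∧ X ⊓ Y = d i) :
    ∀ j ≤ k, d j ≤ cI j x := by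
  intro j
  induction j with
  | zero => intro _; exact h0
  | succ j ih =>
    intro hj
    have hj' := ih (by omega)
    rw [cI_succ]
    obtain ⟨w, w1, w2, w3, w4⟩ := h2 j (by omega) (d (j + 1) ⊓ soc (cI j x))
      (le_inf (h1 j (by omega)) (hj'.trans (le_soc _))) inf_le_left
    have hw : w = d j := by
      by_contra hne
      obtain ⟨a, ha, haw⟩ := exists_cov (lt_of_le_of_ne w1 (Ne.symm hne))
      have : a ≤ d j := by
        rw [← w4]
        exact le_inf (le_inf (haw.trans w2) (cov_le_soc' ha hj')) haw
      exact ha.lt.not_ge this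
    rw [← w3, hw]
    exact sup_le inf_le_right (hj'.trans (le_soc _))

end

section transfer
variable {α β : Type*} [Lattice α] [IsModularLattice α] [OrderTop α] [Fintype α]
  [Lattice β] [IsModularLattice β] [OrderTop β] [Fintype β]

theorem emb_cov (e : β ↪o α) {K : α} (hK' : ∀ a, a ≤ K → ∃ b, e b = a) (hK : ∀ b, e b ≤ K) {a b : β} :
    a ⋖ b ↔ e a ⋖ e b := by
  constructor
  · intro h
    refine ⟨e.lt_iff_lt.mpr h.1, fun t h1 h2 => ?_⟩
    obtain ⟨t', rfl⟩ := hK' t (h2.le.trans (hK b))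
    exact h.2 (e.lt_iff_lt.mp h1) (e.lt_iff_lt.mp h2)
  · intro h
    exact ⟨e.lt_iff_lt.mp h.1, fun t h1 h2 => h.2 (e.lt_iff_lt.mpr h1) (e.lt_iff_lt.mpr h2)⟩

theorem soc_transfer (e : β ↪o α) {K : α} (hK : ∀ b, e b ≤ K) (hK' : ∀ a, a ≤ K → ∃ b, e b = a)
    {z : β} {c : α} (h : e z = K ⊓ c) : e (soc z) = K ⊓ soc c := by
  have hle : e (soc z) ≤ K ⊓ soc c := by
    obtain ⟨w, hw⟩ := hK' (K ⊓ soc c) inf_le_left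
    rw [← hw]
    apply e.monotone
    apply soc_le
    · rw [← e.le_iff_le, hw, h]
      exact inf_le_inf_left _ (le_soc c)
    · intro a ha
      rw [← e.le_iff_le, hw]
      have := (emb_cov e hK' hK).mp ha
      rw [h] at this
      exact le_inf (hK a) (cov_le_soc' this inf_le_right)
  refine le_antisymm hle ?_
  set u := K ⊓ soc c with hu
  set w := e (soc z) with hw
  have hzw : K ⊓ c ≤ w := by rw [← h]; exact e.monotone (le_soc z)
  have huc : c ⊓ u = K ⊓ c := by
    apply le_antisymm
    · exact le_inf (inf_le_right.trans inf_le_left) inf_le_left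
    · exact le_inf inf_le_right (inf_le_inf_left _ (le_soc c))
  have key : c ⊔ u ≤ c ⊔ w := by
    apply soc_atomistic le_sup_left (sup_le (le_soc c) inf_le_right) le_sup_left
    intro a ha hau
    have ea : c ⊔ (a ⊓ u) = a := by
      rw [inf_comm a u, ← sup_inf_assoc_of_le u ha.le]
      exact inf_eq_right.mpr hau
    have hc1 : c ⊓ (a ⊓ u) ⋖ a ⊓ u := by
      apply inf_covBy_of_covBy_sup_left
      rw [ea]
      exact ha
    have hc2 : c ⊓ (a ⊓ u) = K ⊓ c := by
      rw [← inf_assoc, inf_eq_left.mpr ha.le, huc]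
    rw [hc2, ← h] at hc1
    obtain ⟨a', ha'⟩ := hK' (a ⊓ u) (inf_le_right.trans inf_le_left)
    rw [← ha'] at hc1
    have := cov_le_soc ((emb_cov e hK' hK).mpr hc1)
    have h3 : a ⊓ u ≤ w := by rw [← ha']; exact e.monotone this
    rw [← ea]
    exact sup_le_sup_left h3 _
  have : u = w ⊔ (c ⊓ u) := by
    rw [← sup_inf_assoc_of_le c hle]
    refine (inf_eq_right.mpr ?_).symm
    rw [sup_comm w c]
    exact le_sup_right.trans key
  rw [this, huc]
  exact sup_le le_rfl hzw

theorem cI_transfer (e : β ↪o α) {K : α} (hK : ∀ b, e b ≤ K) (hK' : ∀ a, a ≤ K → ∃ b, e b = a)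
    (x : β) (i : ℕ) : e (cI i x) = K ⊓ cI i (e x) := by
  induction i with
  | zero => rw [cI_zero, cI_zero]; exact (inf_eq_right.mpr (hK x)).symm
  | succ i ih =>
    rw [cI_succ, cI_succ]
    exact soc_transfer e hK hK' ih
end transfer
end MomentLat


namespace MomentCat
open MomentLat

set_option linter.unusedSectionVars false
set_option linter.unusedSimpArgs false

section infra
variable {C : Type u} [SmallCategory C] [hC : Fact (IsDiamond C)]

theorem qSup_spec {G : C} (a b : Quotients G) : IsLUB {a, b} (qSup a b) := by
  have h := hC.out.lub G a b
  unfold qSup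
  rw [dif_pos h]
  exact h.choose_spec

theorem qInf_spec {G : C} (a b : Quotients G) : IsGLB {a, b} (qInf a b) := by
  have h := hC.out.glb G a b
  unfold qInf
  rw [dif_pos h]
  exact h.choose_spec

noncomputable instance instLatQ (G : C) : Lattice (Quotients G) :=
  { (inferInstance : PartialOrder (Quotients G)) with
    sup := qSup
    inf := qInf
    le_sup_left := fun a b => (qSup_spec a b).1 (by simp)
    le_sup_right := fun a b => (qSup_spec a b).1 (by simp)
    sup_le := fun a b c h1 h2 => (qSup_spec a b).2 (by
      rintro x (rfl | rfl)
      · exact h1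
      · exact h2)
    inf_le_left := fun a b => (qInf_spec a b).1 (by simp)
    inf_le_right := fun a b => (qInf_spec a b).1 (by simp)
    le_inf := fun a b c h1 h2 => (qInf_spec b c).2 (by
      rintro x (rfl | rfl)
      · exact h1
      · exact h2) }

theorem qSup_eq {G : C} (a b : Quotients G) : qSup a b = a ⊔ b := rfl
theorem qInf_eq {G : C} (a b : Quotients G) : qInf a b = a ⊓ b := rfl

instance instModQ (G : C) : IsModularLattice (Quotients G) where
  sup_inf_le_assoc_of_le {x} y {z} h := (hC.out.modular G x z y h).ge

noncomputable instance instFinQ (G : C) : Fintype (Quotients G) :=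
  haveI := hC.out.quotFinite G
  Fintype.ofFinite _

instance instFinAut (G : C) : Finite (Aut G) := hC.out.autFinite G

theorem mob_of_family {mob : ∀ G : C, Quotients G → Quotients G → ℝ} (h : IsMobiusFamily mob)
    (G : C) : Mob (mob G) := by
  refine ⟨(h G).1, fun x y hxy => ?_⟩
  rw [← (h G).2 x y hxy, finsum_mem_eq_finite_toFinset_sum _ (Set.toFinite _)]
  apply Finset.sum_congr _ (fun _ _ => rfl)
  ext z
  simp

theorem zfn_eq {G F : C} (π : G ⟶ F) (h : Epi π) : Zfn π h = Zc (quotOf π h) := by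
  unfold Zfn Zc MomentLat.Dist
  rw [Nat.card_eq_fintype_card, Fintype.card_subtype]
  congr 1
  ext x
  simp only [Finset.mem_filter, Finset.mem_univ, true_and]
  rfl

theorem qBot_le {G : C} (x : Quotients G) : qBot G ≤ x := by
  have h : ∃ b : Quotients G, ∀ x, b ≤ x :=
    ⟨Finset.univ.inf' ⟨⊤, Finset.mem_univ _⟩ id, fun x => Finset.inf'_le _ (Finset.mem_univ x)⟩
  unfold qBot
  rw [dif_pos h]
  exact h.choose_spec x

theorem cI_of_complexity {G : C} {k : ℕ} (h : complexityLE G k) (x : Quotients G) :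
    cI k x = ⊤ := by
  obtain ⟨c, h0, h1, h2⟩ := h
  let d : ℕ → Quotients G := fun i => if hi : i < k + 1 then c ⟨i, hi⟩ else ⊤
  have hd : ∀ i : Fin k, d i = c i.castSucc ∧ d (i + 1) = c i.succ := by
    intro i
    have := i.2
    refine ⟨?_, ?_⟩
    · simp only [d]; rw [dif_pos (by omega)]; rfl
    · simp only [d]; rw [dif_pos (by omega)]; rfl
  have := cI_complexity k d x ?_ ?_ ?_ k le_rfl
  · have hk : d k = ⊤ := by
      simp only [d]; rw [dif_pos (by omega), ← h1]; rfl
    rw [hk] at this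
    exact top_le_iff.mp this
  · have : d 0 = c 0 := by simp only [d]; rw [dif_pos (by omega)]; rfl
    rw [this, h0]; exact qBot_le x
  · intro i hi
    obtain ⟨e1, e2⟩ := hd ⟨i, hi⟩
    simp only at e1 e2
    rw [e1, e2]
    exact (h2 ⟨i, hi⟩).1
  · intro i hi
    obtain ⟨e1, e2⟩ := hd ⟨i, hi⟩
    simp only at e1 e2
    rw [e1, e2]
    exact (h2 ⟨i, hi⟩).2

end infra

section quot
variable {C : Type u} [SmallCategory C]

theorem quotOf_le_iff {G F E : C} (π : G ⟶ F) (h : Epi π) (ρ : G ⟶ E) (h' : Epi ρ) :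
    quotOf π h ≤ quotOf ρ h' ↔ ∃ φ : E ⟶ F, ρ ≫ φ = π := by
  have := h
  have := h'
  unfold quotOf
  constructor
  · intro hle
    refine ⟨(Subobject.ofMkLEMk _ _ hle).unop, ?_⟩
    apply Quiver.Hom.op_inj
    simp
  · rintro ⟨φ, rfl⟩
    exact Subobject.mk_le_mk_of_comm φ.op rfl

theorem quotOf_eq_iff {G F E : C} (π : G ⟶ F) (h : Epi π) (ρ : G ⟶ E) (h' : Epi ρ) :
    quotOf π h = quotOf ρ h' ↔ ∃ e : E ≅ F, ρ ≫ e.hom = π := by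
  constructor
  · intro he
    obtain ⟨φ, h1⟩ := (quotOf_le_iff π h ρ h').mp he.le
    obtain ⟨ψ, h2⟩ := (quotOf_le_iff ρ h' π h).mp he.ge
    have := h
    have := h'
    refine ⟨⟨φ, ψ, ?_, ?_⟩, h1⟩
    · rw [← cancel_epi ρ, ← Category.assoc, h1, h2, Category.comp_id]
    · rw [← cancel_epi π, ← Category.assoc, h2, h1, Category.comp_id]
  · rintro ⟨e, he⟩
    apply le_antisymm
    · exact (quotOf_le_iff _ _ _ _).mpr ⟨e.hom, he⟩
    · exact (quotOf_le_iff _ _ _ _).mpr ⟨e.inv, by rw [← he]; simp⟩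

theorem quotOf_top_iff {G F : C} (π : G ⟶ F) (h : Epi π) : quotOf π h = ⊤ ↔ IsIso π := by
  have e : (⊤ : Quotients G) = quotOf (𝟙 G) inferInstance := by
    unfold quotOf
    rw [Subobject.top_eq_id]
    rfl
  rw [e, quotOf_eq_iff]
  constructor
  · rintro ⟨e, rfl⟩
    infer_instance
  · intro h
    exact ⟨asIso π, by simp⟩

/-- the tautological quotient map of a quotient class -/
noncomputable def qMap {G : C} (a : Quotients G) : G ⟶ qObj a := (Subobject.arrow a).unop

theorem qMap_epi {G : C} (a : Quotients G) : Epi (qMap a) := by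
  exact unop_epi_of_mono (Subobject.arrow a)

theorem quotOf_qMap {G : C} (a : Quotients G) : quotOf (qMap a) (qMap_epi a) = a := by
  unfold quotOf qMap
  exact Subobject.mk_arrow a

/-- pulling back quotients along an epimorphism -/
noncomputable def pull {H E : C} (ρ : Epis H E) (a : Quotients E) : Quotients H :=
  quotOf (ρ.1 ≫ qMap a) (epiComp ρ.2 (qMap_epi a))

theorem pull_quotOf {H E F : C} (ρ : Epis H E) (τ : E ⟶ F) (h : Epi τ) :
    pull ρ (quotOf τ h) = quotOf (ρ.1 ≫ τ) (epiComp ρ.2 h) := by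
  unfold pull
  rw [quotOf_eq_iff]
  obtain ⟨e, he⟩ := (quotOf_eq_iff _ (qMap_epi (quotOf τ h)) _ h).mp (quotOf_qMap (quotOf τ h))
  exact ⟨e, by rw [Category.assoc, he]⟩

theorem pull_le_iff {H E : C} (ρ : Epis H E) (a b : Quotients E) :
    pull ρ a ≤ pull ρ b ↔ a ≤ b := by
  conv_rhs => rw [← quotOf_qMap a, ← quotOf_qMap b]
  unfold pull
  rw [quotOf_le_iff, quotOf_le_iff]
  have := ρ.2
  constructor
  · rintro ⟨φ, h⟩
    refine ⟨φ, ?_⟩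
    rw [← cancel_epi ρ.1, ← Category.assoc, h]
  · rintro ⟨φ, h⟩
    exact ⟨φ, by rw [Category.assoc, h]⟩

/-- `pull` as an order embedding -/
noncomputable def pullE {H E : C} (ρ : Epis H E) : Quotients E ↪o Quotients H :=
  OrderEmbedding.ofMapLEIff (pull ρ) (pull_le_iff ρ)

theorem pullE_apply {H E : C} (ρ : Epis H E) (a : Quotients E) : pullE ρ a = pull ρ a := rfl

theorem pull_le {H E : C} (ρ : Epis H E) (a : Quotients E) : pull ρ a ≤ quotOf ρ.1 ρ.2 := by
  unfold pull
  rw [quotOf_le_iff]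
  exact ⟨_, rfl⟩

theorem pull_surj {H E : C} (ρ : Epis H E) (a : Quotients H) (ha : a ≤ quotOf ρ.1 ρ.2) :
    ∃ b, pull ρ b = a := by
  rw [← quotOf_qMap a, quotOf_le_iff] at ha
  obtain ⟨φ, hφ⟩ := ha
  have h1 : Epi φ := by
    have := qMap_epi a
    rw [← hφ] at this
    exact epi_of_epi ρ.1 φ
  refine ⟨quotOf φ h1, ?_⟩
  rw [pull_quotOf]
  conv_rhs => rw [← quotOf_qMap a]
  simp only [hφ]

theorem pull_top {H E : C} (ρ : Epis H E) : pull ρ ⊤ = quotOf ρ.1 ρ.2 := by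
  obtain ⟨b, hb⟩ := pull_surj ρ _ le_rfl
  apply le_antisymm (pull_le ρ _)
  rw [← hb, pull_le_iff]
  exact le_top

theorem cI_pull [hC : Fact (IsDiamond C)] {H E : C} (ρ : Epis H E) (x : Quotients E) (i : ℕ) :
    pull ρ (cI i x) = quotOf ρ.1 ρ.2 ⊓ cI i (pull ρ x) :=
  cI_transfer (pullE ρ) (pull_le ρ) (pull_surj ρ) x i

theorem cls_out {X Y : IsoCls C} (e : X.out ≅ Y.out) : X = Y := by
  rw [← Quotient.out_eq X, ← Quotient.out_eq Y]
  exact Quotient.sound ⟨e⟩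

theorem cls_eq {G H : C} (e : G ≅ H) : cls G = cls H := Quotient.sound ⟨e⟩

theorem cls_out_iso (G : C) : Nonempty ((cls G).out ≅ G) := Quotient.exact (Quotient.out_eq (cls G))

theorem cls_out' (X : IsoCls C) : cls X.out = X := Quotient.out_eq X

theorem DownwardClosed.iso {W : Set C} (h : DownwardClosed W) {G H : C} (e : G ≅ H) (hG : G ∈ W) :
    H ∈ W := h G hG H e.hom inferInstance

instance finite_epis [hC : Fact (IsDiamond C)] (G F : C) : Finite (Epis G F) := by
  have : Finite (F ≅ F) := instFinAut F
  rw [← Set.finite_univ_iff]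
  apply Set.Finite.of_finite_fibers (fun π : Epis G F => quotOf π.1 π.2) (Set.toFinite _)
  intro a _
  refine Set.Finite.inter_of_right ?_ _
  by_cases ha : ∃ ρ : Epis G F, quotOf ρ.1 ρ.2 = a
  · obtain ⟨ρ, rfl⟩ := ha
    apply Set.Finite.subset (Set.finite_range (fun e : F ≅ F => (⟨ρ.1 ≫ e.hom,
      epiComp ρ.2 inferInstance⟩ : Epis G F)))
    intro π hπ
    obtain ⟨e, he⟩ := (quotOf_eq_iff _ _ _ _).mp hπ
    exact ⟨e, Subtype.ext he⟩
  · convert Set.finite_empty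
    ext π
    simp only [Set.mem_preimage, Set.mem_singleton_iff, Set.mem_empty_iff_false, iff_false]
    exact fun h => ha ⟨π, h⟩

end quot
end MomentCat


namespace MomentCat
open MomentLat

set_option linter.unusedSectionVars false
set_option linter.unusedSimpArgs false

section fib
variable {α β : Type*} (p : α → β) (w : α → ℕ)

theorem fib_enn (hw : ∀ x, w x ≠ 0) (hc : ∀ x, Nat.card (p ⁻¹' {p x}) = w x) (f : β → ℝ≥0∞)
    (hf : ∀ t, t ∉ Set.range p → f t = 0) :
    ∑' x, f (p x) / (w x : ℝ≥0∞) = ∑' t, f t := by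
  rw [← ENNReal.tsum_fiberwise _ p]
  refine tsum_congr (fun t => ?_)
  by_cases ht : t ∈ Set.range p
  · obtain ⟨x, rfl⟩ := ht
    have h1 : ∀ b : p ⁻¹' {p x}, f (p b) / (w b : ℝ≥0∞) = f (p x) / (w x : ℝ≥0∞) := by
      rintro ⟨b, hb⟩
      have hb' : p b = p x := hb
      simp only
      rw [hb', ← hc b, hb', hc x]
    have : Finite (p ⁻¹' {p x}) := Nat.finite_of_card_ne_zero (by rw [hc]; exact hw x)
    rw [tsum_congr h1, ENNReal.tsum_const, ENat.card_eq_coe_natCard, hc]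
    have h0 : (w x : ℝ≥0∞) ≠ 0 := by exact_mod_cast hw x
    simp only [ENat.toENNReal_coe]
    exact ENNReal.mul_div_cancel h0 (ENNReal.natCast_ne_top _)
  · rw [hf t ht]
    have : IsEmpty (p ⁻¹' {t}) := ⟨fun ⟨x, hx⟩ => ht ⟨x, hx⟩⟩
    simp

theorem fib_real (hw : ∀ x, w x ≠ 0) (hc : ∀ x, Nat.card (p ⁻¹' {p x}) = w x) (f : β → ℝ)
    (hf : ∀ t, t ∉ Set.range p → f t = 0) (hs : Summable f) :
    Summable (fun x => f (p x) / (w x : ℝ)) ∧ ∑' x, f (p x) / (w x : ℝ) = ∑' t, f t := by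
  have h1 : Summable (fun x => f (p x) / (w x : ℝ)) := by
    rw [← summable_abs_iff] at hs ⊢
    have h2 := fib_enn p w hw hc (fun t => ENNReal.ofReal |f t|)
      (fun t ht => by simp [hf t ht])
    rw [← ENNReal.ofReal_tsum_of_nonneg (fun _ => abs_nonneg _) hs] at h2
    have h3 := ENNReal.summable_toReal (h2.trans_ne ENNReal.ofReal_ne_top)
    refine (summable_congr (fun x => ?_)).mpr h3
    rw [abs_div, ENNReal.toReal_div, ENNReal.toReal_ofReal (abs_nonneg _)]
    simp
  refine ⟨h1, ?_⟩
  rw [← (h1.hasSum.tsum_fiberwise p).tsum_eq]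
  refine tsum_congr (fun t => ?_)
  by_cases ht : t ∈ Set.range p
  · obtain ⟨x, rfl⟩ := ht
    have h1 : ∀ b : p ⁻¹' {p x}, f (p b) / (w b : ℝ) = f (p x) / (w x : ℝ) := by
      rintro ⟨b, hb⟩
      have hb' : p b = p x := hb
      simp only
      rw [hb', ← hc b, hb', hc x]
    rw [tsum_congr h1, tsum_const, hc]
    have h0 : (w x : ℝ) ≠ 0 := by exact_mod_cast hw x
    rw [nsmul_eq_mul]
    field_simp
  · rw [hf t ht]
    have : IsEmpty (p ⁻¹' {t}) := ⟨fun ⟨x, hx⟩ => ht ⟨x, hx⟩⟩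
    simp

end fib

section J
variable {C : Type u} [SmallCategory C] {W : Set C}

/-- epimorphisms onto `F` from (representatives of) members of `W` -/
abbrev J (W : Set C) (F : C) := Σ X : WSub W, Epis X.1.out F

/-- source object -/
noncomputable abbrev J.obj {F : C} (j : J W F) : C := j.1.1.out

/-- the quotient class -/
noncomputable def J.cl {F : C} (j : J W F) : Quotients j.obj := quotOf j.2.1 j.2.2

/-- composition -/
noncomputable def J.comp {F : C} (q : J W F) (r : J W q.obj) : J W F :=
  ⟨r.1, r.2.1 ≫ q.2.1, epiComp r.2.2 q.2.2⟩

theorem J.cl_comp {F : C} (q : J W F) (r : J W q.obj) :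
    (J.comp q r).cl = pull r.2 q.cl := (pull_quotOf r.2 q.2.1 q.2.2).symm

theorem J.comp_assoc {F : C} (q : J W F) (r : J W q.obj) (s : J W r.obj) :
    J.comp (J.comp q r) s = J.comp q (J.comp r s) := by
  unfold J.comp
  simp only [Category.assoc]

theorem J.cl_comp_le {F : C} (q : J W F) (r : J W q.obj) :
    (J.comp q r).cl ≤ r.cl := by
  rw [J.cl_comp]
  exact pull_le _ _

/-- the counting map -/
noncomputable def pm (F : C) (x : Σ q : J W F, J W q.obj) : Σ s : J W F, Quotients s.obj :=
  ⟨J.comp x.1 x.2, x.2.cl⟩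

theorem aut_card_ne [hC : Fact (IsDiamond C)] (G : C) : Nat.card (Aut G) ≠ 0 :=
  Nat.card_pos.ne'

theorem pm_range [hC : Fact (IsDiamond C)] (hW : DownwardClosed W) {F : C} (s : J W F)
    (K : Quotients s.obj) (hK : s.cl ≤ K) :
    (⟨s, K⟩ : Σ s : J W F, Quotients s.obj) ∈ Set.range (pm (W := W) F) := by
  obtain ⟨Y, σ, hσ⟩ := s
  change Quotients Y.1.out at K
  change quotOf σ hσ ≤ K at hK
  obtain ⟨e⟩ := cls_out_iso (qObj K)
  have hKW : qObj K ∈ W := hW _ Y.2 _ (qMap K) (qMap_epi K)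
  let X : WSub W := ⟨cls (qObj K), hW.iso e.symm hKW⟩
  let ρ : Y.1.out ⟶ X.1.out := qMap K ≫ e.inv
  have hρ : Epi ρ := epiComp (qMap_epi K) inferInstance
  have hρK : quotOf ρ hρ = K := by
    conv_rhs => rw [← quotOf_qMap K]
    rw [quotOf_eq_iff]
    exact ⟨e.symm, rfl⟩
  have h1 : quotOf σ hσ ≤ quotOf ρ hρ := hK.trans hρK.ge
  obtain ⟨φ, hφ⟩ := (quotOf_le_iff _ _ _ _).mp h1
  have h2 : Epi φ := by
    have := hσ
    rw [← hφ] at this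
    exact epi_of_epi ρ φ
  refine ⟨⟨⟨X, φ, h2⟩, ⟨Y, ρ, hρ⟩⟩, ?_⟩
  change (⟨⟨Y, ρ ≫ φ, _⟩, quotOf ρ hρ⟩ : Σ s : J W F, Quotients s.obj) = ⟨⟨Y, σ, hσ⟩, K⟩
  rw [hρK]
  congr 1
  simp only [hφ]

theorem pm_fib [hC : Fact (IsDiamond C)] {F : C} (x : Σ q : J W F, J W q.obj) :
    Nat.card (pm F ⁻¹' {pm F x}) = Nat.card (Aut x.1.obj) := by
  obtain ⟨⟨Y, φ, hφ⟩, ⟨X, ρ, hρ⟩⟩ := x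
  symm
  apply Nat.card_congr
  refine Equiv.ofBijective (fun e : (Y.1.out ≅ Y.1.out) => ⟨⟨⟨Y, e.inv ≫ φ, epiComp inferInstance hφ⟩,
    ⟨X, ρ ≫ e.hom, epiComp hρ inferInstance⟩⟩, ?_⟩) ⟨?_, ?_⟩
  · have h1 : quotOf (ρ ≫ e.hom) (epiComp hρ inferInstance) = quotOf ρ hρ := by
      rw [quotOf_eq_iff]
      exact ⟨e, rfl⟩
    change (⟨⟨X, (ρ ≫ e.hom) ≫ e.inv ≫ φ, _⟩, quotOf (ρ ≫ e.hom) _⟩ :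
      Σ s : J W F, Quotients s.obj) = ⟨⟨X, ρ ≫ φ, _⟩, quotOf ρ hρ⟩
    rw [h1]
    have h2 : (ρ ≫ e.hom) ≫ e.inv ≫ φ = ρ ≫ φ := by simp
    congr 1
    simp only [h2]
  · intro e e' h
    have h1 := Subtype.ext_iff.mp h
    have h2 := (Sigma.mk.inj_iff.mp h1).2
    have h3 := eq_of_heq h2
    have h4 := eq_of_heq (Sigma.mk.inj_iff.mp h3).2
    have h5 : ρ ≫ e.hom = ρ ≫ e'.hom := congrArg Subtype.val h4
    rw [cancel_epi] at h5
    exact Iso.ext h5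
  · have key : ∀ (Y' X' : WSub W) (φ' : Y'.1.out ⟶ F) (hφ' : Epi φ') (ρ' : X'.1.out ⟶ Y'.1.out)
        (hρ' : Epi ρ'), (⟨⟨X', ρ' ≫ φ', epiComp hρ' hφ'⟩, quotOf ρ' hρ'⟩ :
        Σ s : J W F, Quotients s.obj) = ⟨⟨X, ρ ≫ φ, epiComp hρ hφ⟩, quotOf ρ hρ⟩ →
        ∃ e : Y.1.out ≅ Y.1.out, (⟨⟨Y, e.inv ≫ φ, epiComp inferInstance hφ⟩,
          ⟨X, ρ ≫ e.hom, epiComp hρ inferInstance⟩⟩ : Σ q : J W F, J W q.obj)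
          = ⟨⟨Y', φ', hφ'⟩, ⟨X', ρ', hρ'⟩⟩ := by
      intro Y' X' φ' hφ' ρ' hρ' h0
      obtain ⟨h1, h2⟩ := Sigma.mk.inj_iff.mp h0
      obtain ⟨h3, h4⟩ := Sigma.mk.inj_iff.mp h1
      subst h3
      have h5 : ρ' ≫ φ' = ρ ≫ φ := congrArg Subtype.val (eq_of_heq h4)
      have h6 : quotOf ρ' hρ' = quotOf ρ hρ := eq_of_heq h2
      obtain ⟨e, he⟩ : ∃ e : Y.1.out ≅ Y'.1.out, ρ ≫ e.hom = ρ' := (quotOf_eq_iff _ _ _ _).mp h6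
      have hY : Y = Y' := Subtype.ext (cls_out e)
      subst hY
      subst he
      refine ⟨e, ?_⟩
      have h7 : e.inv ≫ φ = φ' := by
        rw [Iso.inv_comp_eq, ← cancel_epi ρ, ← h5, Category.assoc]
      subst h7
      rfl
    rintro ⟨⟨⟨Y', φ', hφ'⟩, ⟨X', ρ', hρ'⟩⟩, h⟩
    obtain ⟨e, he⟩ := key Y' X' φ' hφ' ρ' hρ' h
    exact ⟨e, Subtype.ext he⟩

theorem count_enn [hC : Fact (IsDiamond C)] (hW : DownwardClosed W) {F : C}
    (Φ : ∀ s : J W F, Quotients s.obj → ℝ≥0∞) (hΦ : ∀ s K, ¬ s.cl ≤ K → Φ s K = 0) :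
    ∑' q : J W F, ∑' r : J W q.obj, Φ (J.comp q r) r.cl / (Nat.card (Aut q.obj) : ℝ≥0∞)
      = ∑' s : J W F, ∑ K, Φ s K := by
  have h := fib_enn (pm (W := W) F) (fun x => Nat.card (Aut x.1.obj)) (fun x => aut_card_ne _) pm_fib
    (fun t => Φ t.1 t.2) (fun t ht => hΦ _ _ (fun h => ht (pm_range hW t.1 t.2 h)))
  refine (ENNReal.tsum_sigma' (fun x : (Σ q : J W F, J W q.obj) => Φ (J.comp x.1 x.2) x.2.cl /
    (Nat.card (Aut x.1.obj) : ℝ≥0∞))).symm.trans (h.trans ((ENNReal.tsum_sigma' _).trans ?_))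
  refine tsum_congr (fun s => ?_)
  rw [tsum_fintype]

theorem count_real [hC : Fact (IsDiamond C)] (hW : DownwardClosed W) {F : C}
    (Φ : ∀ s : J W F, Quotients s.obj → ℝ) (hΦ : ∀ s K, ¬ s.cl ≤ K → Φ s K = 0)
    (hs : Summable (fun s : J W F => ∑ K, |Φ s K|)) :
    Summable (fun q : J W F => ∑' r : J W q.obj, Φ (J.comp q r) r.cl / (Nat.card (Aut q.obj) : ℝ)) ∧
    ∑' q : J W F, ∑' r : J W q.obj, Φ (J.comp q r) r.cl / (Nat.card (Aut q.obj) : ℝ)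
      = ∑' s : J W F, ∑ K, Φ s K := by
  have hs' : Summable (fun t : (Σ s : J W F, Quotients s.obj) => Φ t.1 t.2) := by
    rw [← summable_abs_iff, summable_sigma_of_nonneg (fun _ => abs_nonneg _)]
    refine ⟨fun _ => Summable.of_finite, ?_⟩
    simpa only [tsum_fintype] using hs
  have h := fib_real (pm (W := W) F) (fun x => Nat.card (Aut x.1.obj)) (fun x => aut_card_ne _) pm_fib
    (fun t => Φ t.1 t.2) (fun t ht => hΦ _ _ (fun h => ht (pm_range hW t.1 t.2 h))) hs'
  refine ⟨h.1.sigma, ?_⟩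
  have h2 := h.2
  rw [h.1.tsum_sigma, hs'.tsum_sigma] at h2
  refine Eq.trans h2 ?_
  refine tsum_congr (fun s => ?_)
  rw [tsum_fintype]

end J
end MomentCat


namespace MomentLat
set_option linter.unusedSectionVars false
set_option linter.unusedSimpArgs false
section
variable {α : Type*} [Lattice α] [IsModularLattice α] [OrderTop α] [Fintype α]

theorem step_inner {m : α → α → ℝ} (hm : Mob m) (x t : α) (i : ℕ) :
    ∑ K, (if K ⊓ cI i x = t ∧ cI (i + 1) x = ⊤ then m K ⊤ else 0)
      = if cI i x = ⊤ then m t ⊤ else 0 := by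
  by_cases hA : cI i x = ⊤
  · rw [if_pos hA, hA]
    have h1 := cI_top_succ hA
    simp [h1]
  · rw [if_neg hA]
    by_cases h1 : cI (i + 1) x = ⊤
    · simp only [h1, and_true]
      rw [← Finset.sum_filter]
      by_cases ht : t ≤ cI i x
      · exact weisner' hm hA t ht
      · apply Finset.sum_eq_zero
        intro K hK
        rw [Finset.mem_filter] at hK
        exact absurd (hK.2 ▸ inf_le_right) ht
    · simp [h1]

theorem step_bound {m : α → α → ℝ} (hm : Mob m) (x t : α) (i : ℕ) :
    ∑ K, |if K ⊓ cI i x = t ∧ cI (i + 1) x = ⊤ then m K ⊤ else 0|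
      ≤ (Zc t : ℝ) ^ 3 * |m t ⊤| := by
  by_cases hz : ∀ K, (if K ⊓ cI i x = t ∧ cI (i + 1) x = ⊤ then m K ⊤ else 0) = 0
  · simp only [hz, abs_zero, Finset.sum_const_zero]
    positivity
  · push Not at hz
    obtain ⟨K, hK⟩ := hz
    have hK1 : K ⊓ cI i x = t ∧ cI (i + 1) x = ⊤ := by
      by_contra h
      exact hK (if_neg h)
    rw [if_pos hK1] at hK
    have q1 : Qm K := qm_of_mob hm hK
    have q2 : Qm (cI i x) := (sm_of_soc (by rw [← cI_succ]; exact hK1.2)).qm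
    have q3 : Sm t := hK1.1 ▸ (q1.inf q2).sm
    refine le_trans ?_ (bound hm q3)
    unfold Fs
    rw [Finset.sum_filter]
    apply Finset.sum_le_sum
    intro L _
    by_cases hL : L ⊓ cI i x = t ∧ cI (i + 1) x = ⊤
    · rw [if_pos hL, if_pos (hL.1 ▸ inf_le_left)]
    · rw [if_neg hL, abs_zero]
      split_ifs
      · exact abs_nonneg _
      · exact le_rfl
end
end MomentLat

namespace MomentCat
open MomentLat
set_option linter.unusedSectionVars false
set_option linter.unusedSimpArgs false

section main
variable {C : Type u} [SmallCategory C] {W : Set C} [hC : Fact (IsDiamond C)]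

/-- the weight of `s` -/
noncomputable def mm (mob : ∀ G : C, Quotients G → Quotients G → ℝ) (M : IsoCls C → ℝ)
    {F : C} (s : J W F) : ℝ :=
  mob s.obj s.cl ⊤ * M s.1.1 / (Nat.card (Aut s.obj) : ℝ)

/-- partial sums indexed by the height of the iterated socle -/
noncomputable def aI (mob : ∀ G : C, Quotients G → Quotients G → ℝ) (M : IsoCls C → ℝ) (i : ℕ)
    {G : C} (φ : J W G) : ℝ :=
  ∑' s : J W φ.obj, if cI i (J.comp φ s).cl = ⊤ then mm mob M s else 0

theorem cl_comp_assoc {F : C} (q : J W F) (r : J W q.obj) (s : J W r.obj) :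
    ((J.comp q (J.comp r s)).cl : Quotients s.obj) = (J.comp (J.comp q r) s).cl := by
  change quotOf ((s.2.1 ≫ r.2.1) ≫ q.2.1) _ = quotOf (s.2.1 ≫ r.2.1 ≫ q.2.1) _
  simp only [Category.assoc]

theorem Zfn_cl {F : C} (s : J W F) : Zfn s.2.1 s.2.2 = Zc s.cl := zfn_eq _ _

theorem step (mob : ∀ G : C, Quotients G → Quotients G → ℝ) (hmob : IsMobiusFamily mob)
    (M : IsoCls C → ℝ) (hW : DownwardClosed W) (hwb : WellBehavedAt mob M W) (i : ℕ) {G : C}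
    (φ : J W G) :
    Summable (fun q : J W φ.obj => (if cI i (J.comp φ q).cl = q.cl then
      aI mob M (i + 1) (J.comp φ q) else 0) / (Nat.card (Aut q.obj) : ℝ)) ∧
    ∑' q : J W φ.obj, (if cI i (J.comp φ q).cl = q.cl then
      aI mob M (i + 1) (J.comp φ q) else 0) / (Nat.card (Aut q.obj) : ℝ) = aI mob M i φ := by
  let Φ : ∀ s : J W φ.obj, Quotients s.obj → ℝ := fun s K =>
    (if K ⊓ cI i (J.comp φ s).cl = s.cl ∧ cI (i + 1) (J.comp φ s).cl = ⊤ then mob s.obj K ⊤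
      else 0) * (M s.1.1 / (Nat.card (Aut s.obj) : ℝ))
  have hΦ : ∀ s K, ¬ s.cl ≤ K → Φ s K = 0 := by
    intro s K h
    simp only [Φ]
    rw [if_neg, zero_mul]
    rintro ⟨h1, -⟩
    exact h (h1 ▸ inf_le_left)
  have hs : Summable (fun s : J W φ.obj => ∑ K, |Φ s K|) := by
    refine Summable.of_nonneg_of_le (fun s => Finset.sum_nonneg (fun _ _ => abs_nonneg _))
      (fun s => ?_) (hwb φ.obj φ.1.2)
    have h1 := step_bound (mob_of_family hmob s.obj) (J.comp φ s).cl s.cl i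
    simp only [Φ, abs_mul, ← Finset.sum_mul]
    rw [Zfn_cl]
    have h2 : (0:ℝ) ≤ |M s.1.1 / (Nat.card (Aut s.obj) : ℝ)| := abs_nonneg _
    refine (mul_le_mul_of_nonneg_right h1 h2).trans (le_of_eq ?_)
    rw [abs_div, Nat.abs_cast]
    unfold J.cl
    ring
  obtain ⟨c1, c2⟩ := count_real hW Φ hΦ hs
  have key : ∀ q : J W φ.obj, ∑' r : J W q.obj, Φ (J.comp q r) r.cl / (Nat.card (Aut q.obj) : ℝ)
      = (if cI i (J.comp φ q).cl = q.cl then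
      aI mob M (i + 1) (J.comp φ q) else 0) / (Nat.card (Aut q.obj) : ℝ) := by
    intro q
    rw [tsum_div_const]
    congr 1
    have e : ∀ r : J W q.obj, Φ (J.comp q r) r.cl =
        if cI i (J.comp φ q).cl = q.cl then
          (if cI (i + 1) (J.comp (J.comp φ q) r).cl = ⊤ then mm mob M r else 0) else 0 := by
      intro r
      have e1 : (r.cl ⊓ cI i (J.comp φ (J.comp q r)).cl = (J.comp q r).cl) ↔
          cI i (J.comp φ q).cl = q.cl := by
        rw [cl_comp_assoc, J.cl_comp, J.cl_comp (J.comp φ q) r]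
        have h3 := cI_pull r.2 (J.comp φ q).cl i
        have h4 : r.cl ⊓ cI i (pull r.2 (J.comp φ q).cl) = pull r.2 (cI i (J.comp φ q).cl) := h3.symm
        refine Iff.trans (b := pull r.2 (cI i (J.comp φ q).cl) = pull r.2 q.cl) ?_ ?_
        · exact ⟨fun h => h4.symm.trans h, fun h => h4.trans h⟩
        · exact (pullE r.2).injective.eq_iff
      have e2 : cI (i + 1) (J.comp φ (J.comp q r)).cl = ⊤ ↔
          cI (i + 1) (J.comp (J.comp φ q) r).cl = ⊤ := by
        rw [cl_comp_assoc]
        exact Iff.rfl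
      simp only [Φ]
      by_cases h1 : cI i (J.comp φ q).cl = q.cl
      · rw [if_pos h1]
        by_cases h2 : cI (i + 1) (J.comp (J.comp φ q) r).cl = ⊤
        · rw [if_pos h2, if_pos ⟨e1.mpr h1, e2.mpr h2⟩]
          unfold mm
          rw [mul_div_assoc]
          rfl
        · rw [if_neg h2, if_neg (fun h => h2 (e2.mp h.2)), zero_mul]
      · rw [if_neg h1, if_neg (fun h => h1 (e1.mp h.1)), zero_mul]
    rw [tsum_congr e]
    by_cases h1 : cI i (J.comp φ q).cl = q.cl
    · simp only [if_pos h1]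
      rfl
    · simp only [if_neg h1, tsum_zero]
  simp only [key] at c1 c2
  refine ⟨c1, c2.trans ?_⟩
  unfold aI
  refine tsum_congr (fun s => ?_)
  simp only [Φ]
  rw [← Finset.sum_mul]
  have h1 := step_inner (mob_of_family hmob s.obj) (J.comp φ s).cl s.cl i
  refine (congrArg (· * (M s.1.1 / (Nat.card (Aut s.obj) : ℝ))) h1).trans ?_
  by_cases h : cI i (J.comp φ s).cl = ⊤
  · rw [if_pos h]
    refine (congrArg (· * (M s.1.1 / (Nat.card (Aut s.obj) : ℝ))) (if_pos h)).trans ?_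
    unfold mm
    rw [mul_div_assoc]
  · rw [if_neg h]
    refine (congrArg (· * (M s.1.1 / (Nat.card (Aut s.obj) : ℝ))) (if_neg h)).trans ?_
    simp only [zero_mul]

end main
end MomentCat


namespace MomentCat
open MomentLat
set_option linter.unusedSectionVars false
set_option linter.unusedSimpArgs false

section main2
variable {C : Type u} [SmallCategory C] {W : Set C} [hC : Fact (IsDiamond C)]

theorem mm_summable (mob : ∀ G : C, Quotients G → Quotients G → ℝ)
    (M : IsoCls C → ℝ) (hwb : WellBehavedAt mob M W) {F : C} (hF : F ∈ W) :
    Summable (fun s : J W F => mm mob M s) := by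
  rw [← summable_abs_iff]
  refine Summable.of_nonneg_of_le (fun s => abs_nonneg _) (fun s => ?_) (hwb F hF)
  rw [Zfn_cl]
  unfold mm
  rw [abs_div, abs_mul, Nat.abs_cast]
  have h1 : (1:ℝ) ≤ (Zc s.cl : ℝ) ^ 3 := one_le_pow₀ (by exact_mod_cast Zc_pos s.cl)
  have h2 : 0 ≤ |mob s.obj s.cl ⊤| / (Nat.card (Aut s.obj) : ℝ) * |M s.1.1| := by positivity
  have h3 := mul_le_mul_of_nonneg_left h1 h2
  calc |mob s.obj s.cl ⊤| * |M s.1.1| / (Nat.card (Aut s.obj) : ℝ)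
      = |mob s.obj s.cl ⊤| / (Nat.card (Aut s.obj) : ℝ) * |M s.1.1| * 1 := by ring
    _ ≤ _ := h3
    _ = _ := by unfold J.cl; ring

theorem mm_tsum (mob : ∀ G : C, Quotients G → Quotients G → ℝ)
    (M : IsoCls C → ℝ) (hwb : WellBehavedAt mob M W) {F : C} (hF : F ∈ W) :
    ∑' s : J W F, mm mob M s = (Nat.card (Aut F) : ℝ) * vWF mob M W F := by
  rw [(mm_summable mob M hwb hF).tsum_sigma]
  unfold vWF
  rw [← tsum_mul_left]
  refine tsum_congr (fun X => ?_)
  unfold mm muHat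
  have h0 : (Nat.card (Aut F) : ℝ) ≠ 0 := by exact_mod_cast aut_card_ne F
  have : ∀ c : Epis X.1.out F, mob (J.obj (W := W) ⟨X, c⟩) (J.cl (W := W) ⟨X, c⟩) ⊤ * M X.1 /
      (Nat.card (Aut (J.obj (W := W) ⟨X, c⟩)) : ℝ)
      = muEpi mob c.1 c.2 * (M X.1 / (Nat.card (Aut X.1.out) : ℝ)) := by
    intro c
    rw [mul_div_assoc]
    rfl
  rw [tsum_congr this, tsum_mul_right]
  field_simp

theorem aI_top (mob : ∀ G : C, Quotients G → Quotients G → ℝ)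
    (M : IsoCls C → ℝ) (hwb : WellBehavedAt mob M W) {k : ℕ}
    (hk : ∀ G ∈ W, complexityLE G k) {G : C} (φ : J W G) :
    aI mob M k φ = (Nat.card (Aut φ.obj) : ℝ) * vWF mob M W φ.obj := by
  rw [← mm_tsum mob M hwb φ.1.2]
  unfold aI
  refine tsum_congr (fun s => ?_)
  rw [if_pos]
  exact cI_of_complexity (hk s.obj s.1.2) _

theorem aI_nonneg (mob : ∀ G : C, Quotients G → Quotients G → ℝ) (hmob : IsMobiusFamily mob)
    (M : IsoCls C → ℝ) (hW : DownwardClosed W) (hwb : WellBehavedAt mob M W) {k : ℕ}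
    (hk : ∀ G ∈ W, complexityLE G k) (hv : ∀ F : C, F ∈ W → 0 ≤ vWF mob M W F) (d : ℕ) :
    ∀ (i : ℕ), i + d = k → ∀ {G : C} (φ : J W G), 0 ≤ aI mob M i φ := by
  induction d with
  | zero =>
    intro i hi G φ
    rw [add_zero] at hi
    subst hi
    rw [aI_top mob M hwb hk]
    exact mul_nonneg (Nat.cast_nonneg _) (hv _ φ.1.2)
  | succ d ih =>
    intro i hi G φ
    rw [← (step mob hmob M hW hwb i φ).2]
    refine tsum_nonneg (fun q => div_nonneg ?_ (Nat.cast_nonneg _))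
    split_ifs
    · exact ih (i + 1) (by omega) _
    · exact le_rfl

/-- the truncated moment sums -/
noncomputable def TI (mob : ∀ G : C, Quotients G → Quotients G → ℝ) (M : IsoCls C → ℝ) (W : Set C)
    (i : ℕ) (G : C) : ℝ≥0∞ :=
  ∑' φ : J W G, ENNReal.ofReal (aI mob M i φ) / (Nat.card (Aut φ.obj) : ℝ≥0∞)

theorem TI_succ (mob : ∀ G : C, Quotients G → Quotients G → ℝ) (hmob : IsMobiusFamily mob)
    (M : IsoCls C → ℝ) (hW : DownwardClosed W) (hwb : WellBehavedAt mob M W) (i : ℕ)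
    (hn : ∀ {G : C} (φ : J W G), 0 ≤ aI mob M (i + 1) φ) (G : C) :
    TI mob M W i G = TI mob M W (i + 1) G := by
  let Φ : ∀ s : J W G, Quotients s.obj → ℝ≥0∞ := fun ψ K =>
    if cI i ψ.cl = K then ENNReal.ofReal (aI mob M (i + 1) ψ) / (Nat.card (Aut ψ.obj) : ℝ≥0∞) else 0
  have h := count_enn hW Φ (by
    intro s K h
    simp only [Φ]
    rw [if_neg]
    rintro rfl
    exact h (le_cI _ _))
  have h2 : ∀ ψ : J W G, ∑ K, Φ ψ K =
      ENNReal.ofReal (aI mob M (i + 1) ψ) / (Nat.card (Aut ψ.obj) : ℝ≥0∞) := by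
    intro ψ
    simp [Φ]
  simp only [h2] at h
  unfold TI
  rw [← h]
  refine tsum_congr (fun φ => ?_)
  obtain ⟨s1, s2⟩ := step mob hmob M hW hwb i φ
  have hnn : ∀ q : J W φ.obj, 0 ≤ (if cI i (J.comp φ q).cl = q.cl then
      aI mob M (i + 1) (J.comp φ q) else 0) / (Nat.card (Aut q.obj) : ℝ) := by
    intro q
    refine div_nonneg ?_ (Nat.cast_nonneg _)
    split_ifs
    · exact hn _
    · exact le_rfl
  rw [← s2, ENNReal.ofReal_tsum_of_nonneg hnn s1]
  simp only [div_eq_mul_inv]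
  rw [← ENNReal.tsum_mul_right]
  refine tsum_congr (fun q => ?_)
  congr 1
  simp only [Φ]
  by_cases hq : cI i (J.comp φ q).cl = q.cl
  · rw [if_pos hq, if_pos hq, ← div_eq_mul_inv, ENNReal.ofReal_div_of_pos, ENNReal.ofReal_natCast]
    · rfl
    · exact_mod_cast Nat.pos_of_ne_zero (aut_card_ne _)
  · rw [if_neg hq, if_neg hq]
    simp

theorem iso_class {E : C} (s : J W E) (hs : s.cl = ⊤) : s.1.1 = cls E := by
  have h1 : IsIso s.2.1 := (quotOf_top_iff _ _).mp hs
  have : s.1.1 = cls s.1.1.out := (cls_out' _).symm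
  rw [this]
  exact cls_eq (asIso s.2.1)

theorem iso_card (hW : DownwardClosed W) {E : C} (hE : E ∈ W) :
    Nat.card {s : J W E | s.cl = ⊤} = Nat.card (Aut (cls E).out) := by
  obtain ⟨e0⟩ := cls_out_iso E
  symm
  apply Nat.card_congr
  refine Equiv.ofBijective (fun a : ((cls E).out ≅ (cls E).out) =>
    ⟨⟨⟨cls E, hW.iso e0.symm hE⟩, a.hom ≫ e0.hom, inferInstance⟩,
      (quotOf_top_iff _ _).mpr inferInstance⟩) ⟨?_, ?_⟩
  · intro a b h
    have h1 := Subtype.ext_iff.mp h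
    have h2 := eq_of_heq (Sigma.mk.inj_iff.mp h1).2
    have h3 : a.hom ≫ e0.hom = b.hom ≫ e0.hom := congrArg Subtype.val h2
    rw [cancel_mono] at h3
    exact Iso.ext h3
  · rintro ⟨⟨⟨Y, hY⟩, σ, hσ⟩, hs⟩
    have h1 : Y = cls E := iso_class (W := W) ⟨⟨Y, hY⟩, σ, hσ⟩ hs
    have h2 : IsIso σ := (quotOf_top_iff _ _).mp hs
    subst h1
    refine ⟨asIso σ ≪≫ e0.symm, ?_⟩
    simp

theorem iso_finite (hW : DownwardClosed W) {E : C} (hE : E ∈ W) :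
    Finite {s : J W E | s.cl = ⊤} :=
  Nat.finite_of_card_ne_zero (by rw [iso_card hW hE]; exact aut_card_ne _)

theorem aI_zero (mob : ∀ G : C, Quotients G → Quotients G → ℝ) (hmob : IsMobiusFamily mob)
    (M : IsoCls C → ℝ) (hW : DownwardClosed W) {G : C} (φ : J W G) :
    aI mob M 0 φ = if φ.cl = ⊤ then M (cls G) else 0 := by
  have hcl : ∀ s : J W φ.obj, (J.comp φ s).cl = ⊤ ↔ φ.cl = ⊤ ∧ s.cl = ⊤ := by
    intro s
    rw [J.cl_comp]
    constructor
    · intro h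
      have h1 : pull s.2 φ.cl = ⊤ := h
      have h2 : s.cl = ⊤ := top_le_iff.mp (h1 ▸ pull_le s.2 φ.cl)
      refine ⟨?_, h2⟩
      apply (pullE s.2).injective
      rw [pullE_apply, pullE_apply, pull_top, h1]
      exact h2.symm
    · rintro ⟨h1, h2⟩
      have h3 : pull s.2 φ.cl = ⊤ := by
        rw [h1, pull_top]
        exact h2
      exact h3
  unfold aI
  by_cases hφ : φ.cl = ⊤
  · rw [if_pos hφ]
    have e : ∀ s : J W φ.obj, (if cI 0 (J.comp φ s).cl = ⊤ then mm mob M s else 0) =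
        Set.indicator {s : J W φ.obj | s.cl = ⊤}
          (fun _ => M (cls G) / (Nat.card (Aut (cls φ.obj).out) : ℝ)) s := by
      intro s
      rw [cI_zero]
      by_cases hs : s.cl = ⊤
      · rw [if_pos ((hcl s).mpr ⟨hφ, hs⟩), Set.indicator_of_mem (by exact hs)]
        unfold mm
        rw [hs, (mob_of_family hmob s.obj).1, one_mul]
        have h1 := iso_class s hs
        have h2 : cls φ.obj = cls G := by
          rw [← iso_class φ hφ]
          exact cls_out' _
        unfold J.obj at *
        rw [h1, h2]
      · rw [if_neg (fun h => hs ((hcl s).mp h).2), Set.indicator_of_notMem (by exact hs)]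
    rw [tsum_congr e, ← tsum_subtype, tsum_const, iso_card hW φ.1.2, nsmul_eq_mul]
    have h0 : (Nat.card (Aut (cls φ.obj).out) : ℝ) ≠ 0 := by exact_mod_cast aut_card_ne _
    field_simp
  · rw [if_neg hφ]
    have e : ∀ s : J W φ.obj, (if cI 0 (J.comp φ s).cl = ⊤ then mm mob M s else 0) = 0 := by
      intro s
      rw [cI_zero, if_neg (fun h => hφ ((hcl s).mp h).1)]
    rw [tsum_congr e, tsum_zero]

theorem TI_zero (mob : ∀ G : C, Quotients G → Quotients G → ℝ) (hmob : IsMobiusFamily mob)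
    (M : IsoCls C → ℝ) (hW : DownwardClosed W) {G : C} (hG : G ∈ W) :
    TI mob M W 0 G = ENNReal.ofReal (M (cls G)) := by
  unfold TI
  have e : ∀ φ : J W G, ENNReal.ofReal (aI mob M 0 φ) / (Nat.card (Aut φ.obj) : ℝ≥0∞)
      = Set.indicator {s : J W G | s.cl = ⊤}
        (fun _ => ENNReal.ofReal (M (cls G)) / (Nat.card (Aut (cls G).out) : ℝ≥0∞)) φ := by
    intro φ
    rw [aI_zero mob hmob M hW]
    by_cases hs : φ.cl = ⊤
    · rw [if_pos hs, Set.indicator_of_mem (by exact hs)]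
      have h1 := iso_class φ hs
      unfold J.obj
      rw [h1]
    · rw [if_neg hs, Set.indicator_of_notMem (by exact hs)]
      simp
  have := iso_finite hW hG
  rw [tsum_congr e, ← tsum_subtype, ENNReal.tsum_const, ENat.card_eq_coe_natCard, iso_card hW hG]
  simp only [ENat.toENNReal_coe]
  exact ENNReal.mul_div_cancel (by exact_mod_cast aut_card_ne _) (ENNReal.natCast_ne_top _)

theorem TI_top (mob : ∀ G : C, Quotients G → Quotients G → ℝ)
    (M : IsoCls C → ℝ) (hwb : WellBehavedAt mob M W) {k : ℕ}
    (hk : ∀ G ∈ W, complexityLE G k) (G : C) :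
    TI mob M W k G = ∑' X : WSub W, (Nat.card (Epis X.1.out G) : ℝ≥0∞) *
      ENNReal.ofReal (vWF mob M W X.1.out) := by
  unfold TI
  have e : ∀ φ : J W G, ENNReal.ofReal (aI mob M k φ) / (Nat.card (Aut φ.obj) : ℝ≥0∞)
      = ENNReal.ofReal (vWF mob M W φ.1.1.out) := by
    intro φ
    rw [aI_top mob M hwb hk, ENNReal.ofReal_mul (Nat.cast_nonneg _), ENNReal.ofReal_natCast]
    have h0 : (Nat.card (Aut φ.obj) : ℝ≥0∞) ≠ 0 := by exact_mod_cast aut_card_ne _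
    rw [mul_div_assoc]
    exact ENNReal.mul_div_cancel h0 (ENNReal.natCast_ne_top _)
  rw [tsum_congr e]
  refine (ENNReal.tsum_sigma' _).trans (tsum_congr (fun X => ?_))
  simp only
  rw [ENNReal.tsum_const, ENat.card_eq_coe_natCard]
  simp

theorem moments (mob : ∀ G : C, Quotients G → Quotients G → ℝ) (hmob : IsMobiusFamily mob)
    (M : IsoCls C → ℝ) (hW : DownwardClosed W) (hwb : WellBehavedAt mob M W) {k : ℕ}
    (hk : ∀ G ∈ W, complexityLE G k) (hv : ∀ F : C, F ∈ W → 0 ≤ vWF mob M W F) {G : C}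
    (hG : G ∈ W) :
    0 ≤ M (cls G) ∧ ∑' X : WSub W, (Nat.card (Epis X.1.out G) : ℝ≥0∞) *
      ENNReal.ofReal (vWF mob M W X.1.out) = ENNReal.ofReal (M (cls G)) := by
  have hnn : ∀ i ≤ k, ∀ {G : C} (φ : J W G), 0 ≤ aI mob M i φ := fun i hi =>
    aI_nonneg mob hmob M hW hwb hk hv (k - i) i (by omega)
  constructor
  · have := iso_card hW hG
    have hne : Nat.card {s : J W G | s.cl = ⊤} ≠ 0 := by rw [this]; exact aut_card_ne _
    obtain ⟨⟨φ, hφ⟩⟩ := (Nat.card_ne_zero.mp hne).1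
    have h1 := hnn 0 (Nat.zero_le _) φ
    rw [aI_zero mob hmob M hW, if_pos (show φ.cl = ⊤ from hφ)] at h1
    exact h1
  · rw [← TI_top mob M hwb hk, ← TI_zero mob hmob M hW hG]
    have : ∀ j ≤ k, TI mob M W j G = TI mob M W 0 G := by
      intro j
      induction j with
      | zero => intro _; rfl
      | succ j ih =>
        intro hj
        rw [← ih (by omega)]
        exact (TI_succ mob hmob M hW hwb j (hnn (j + 1) hj) G).symm
    exact this k le_rfl

end main2
end MomentCat


namespace MomentCat
open MomentLat
set_option linter.unusedSectionVars false
set_option linter.unusedSimpArgs false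

section part2
variable {C : Type u} [SmallCategory C] [hC : Fact (IsDiamond C)]

theorem exists_top_quot {W : Set C} (hW : IsFormation W) (G : C) :
    ∃ K : Quotients G, qObj K ∈ W ∧ ∀ a, qObj a ∈ W → a ≤ K := by
  have hne : {a : Quotients G | qObj a ∈ W}.Nonempty := by
    refine ⟨qBot G, hW.2.2 _ ⟨fun a b => ?_⟩⟩
    let ρ : Epis G (qObj (qBot G)) := ⟨qMap _, qMap_epi _⟩
    apply (pullE ρ).injective
    have h : ∀ a, pullE ρ a = qBot G := fun a =>
      le_antisymm ((pull_le ρ a).trans (quotOf_qMap _).le) (qBot_le _)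
    rw [h, h]
  obtain ⟨K, hK⟩ := (Set.toFinite {a : Quotients G | qObj a ∈ W}).exists_maximal hne
  refine ⟨K, hK.prop, fun a ha => ?_⟩
  have h1 : qObj (qSup K a) ∈ W := hW.2.1 G K a hK.prop ha ⟨_, qSup_spec K a⟩
  have h2 : qSup K a ≤ K := hK.le_of_ge (y := qSup K a) h1 (le_sup_left : K ≤ K ⊔ a)
  exact (le_sup_right : a ≤ K ⊔ a).trans h2

theorem exists_trunc {W : Set C} (hW : IsFormation W) (G : C) :
    ∃ Y : WSub W, ∀ F ∈ W, Nat.card (Epis Y.1.out F) = Nat.card (Epis G F) := by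
  obtain ⟨K, hK, hmax⟩ := exists_top_quot hW G
  obtain ⟨e⟩ := cls_out_iso (qObj K)
  refine ⟨⟨cls (qObj K), hW.1.iso e.symm hK⟩, fun F hF => ?_⟩
  let ρ : G ⟶ (cls (qObj K)).out := qMap K ≫ e.inv
  have hρ : Epi ρ := epiComp (qMap_epi K) inferInstance
  apply Nat.card_congr
  refine Equiv.ofBijective (fun τ => ⟨ρ ≫ τ.1, epiComp hρ τ.2⟩) ⟨?_, ?_⟩
  · intro τ τ' h
    have h1 : ρ ≫ τ.1 = ρ ≫ τ'.1 := congrArg Subtype.val h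
    rw [cancel_epi] at h1
    exact Subtype.ext h1
  · rintro ⟨π, hπ⟩
    obtain ⟨e', -⟩ := (quotOf_eq_iff _ _ _ _).mp (quotOf_qMap (quotOf π hπ))
    have h1 : quotOf π hπ ≤ K := hmax _ (hW.1.iso e' hF)
    rw [← quotOf_qMap K, quotOf_le_iff] at h1
    obtain ⟨φ, hφ⟩ := h1
    have h2 : ρ ≫ e.hom ≫ φ = π := by simp [ρ, hφ]
    refine ⟨⟨e.hom ≫ φ, ?_⟩, Subtype.ext h2⟩
    have := hπ
    rw [← h2] at this
    exact epi_of_epi ρ _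

end part2

theorem exists_measure {C : Type u} [SmallCategory C] (W : Set C) (g : WSub W → ℝ≥0∞) :
    ∃ ν : MeasureTheory.Measure (WSub W), ∀ F, ν {F} = g F := by
  have hm : ∀ s : Set (WSub W), MeasurableSet s := fun s => trivial
  refine ⟨Measure.sum (fun E => g E • Measure.dirac E), fun F => ?_⟩
  rw [Measure.sum_apply _ (hm _), tsum_eq_single F]
  · simp [Measure.dirac_apply' _ (hm _)]
  · intro E hE
    simp [Measure.dirac_apply' _ (hm _), hE]

theorem real_moment {ι : Type*} (n : ι → ℕ) (g : ι → ℝ≥0∞) (hg : ∀ i, g i ≠ ∞) {m : ℝ} (hm : 0 ≤ m)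
    (h : ∑' i, (n i : ℝ≥0∞) * g i = ENNReal.ofReal m) : ∑' i, (n i : ℝ) * (g i).toReal = m := by
  have h1 := congrArg ENNReal.toReal h
  rw [ENNReal.toReal_ofReal hm, ENNReal.tsum_toReal_eq
    (fun i => ENNReal.mul_ne_top (ENNReal.natCast_ne_top _) (hg i))] at h1
  simpa using h1

end MomentCat

open MomentCat in
/-- Existence, Theorem 4.10: for a narrow formation `W` of
finite complexity and `(M_G)` well-behaved at `W` with `v_{W,F} ≥ 0`, the
assignment `ν_W({F}) = v_{W,F}` defines a measure on `W` (with the discrete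
σ-algebra) whose `G`-moment is `M_G` for every `G ∈ W`; and for every formation
`W' ⊆ W` there is a measure on `W'` with `G`-moment `M_G` for every `G ∈ W'`. -/
theorem statement9 {C : Type u} [SmallCategory C] (hC : IsDiamond C)
    (mob : ∀ G : C, Quotients G → Quotients G → ℝ) (hmob : IsMobiusFamily mob)
    (W : Set C) (hW : IsFormation W) (hWn : Narrow W)
    (hfc : ∃ k : ℕ, ∀ G ∈ W, complexityLE G k)
    (M : IsoCls C → ℝ) (hwb : WellBehavedAt mob M W)
    (hv : ∀ F : C, F ∈ W → 0 ≤ vWF mob M W F) :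
    (∃ ν : MeasureTheory.Measure (WSub W),
      (∀ F : WSub W, ν {F} = ENNReal.ofReal (vWF mob M W F.1.out)) ∧
      (∀ G : C, G ∈ W →
        ∑' F : WSub W, (Nat.card (Epis F.1.out G) : ℝ) * (ν {F}).toReal = M (cls G))) ∧
    (∀ W' : Set C, W' ⊆ W → IsFormation W' →
      ∃ ν' : MeasureTheory.Measure (WSub W'),
        ∀ G : C, G ∈ W' →
          ∑' F : WSub W', (Nat.card (Epis F.1.out G) : ℝ) * (ν' {F}).toReal
            = M (cls G)) := by
  have : Fact (IsDiamond C) := ⟨hC⟩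
  obtain ⟨k, hk⟩ := hfc
  have hmom : ∀ {G : C}, G ∈ W → _ := fun {G} hG => moments mob hmob M hW.1 hwb hk hv hG
  refine ⟨?_, ?_⟩
  · obtain ⟨ν, hν⟩ := exists_measure W (fun F => ENNReal.ofReal (vWF mob M W F.1.out))
    refine ⟨ν, hν, fun G hG => ?_⟩
    simp only [hν]
    exact real_moment _ _ (fun _ => ENNReal.ofReal_ne_top) (hmom hG).1 (hmom hG).2
  · intro W' hsub hW'
    have ht : ∀ E : WSub W, ∃ Y : WSub W', ∀ F ∈ W',
      Nat.card (Epis Y.1.out F) = Nat.card (Epis E.1.out F) := fun E => exists_trunc hW' _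
    choose t ht using ht
    obtain ⟨ν, hν⟩ := exists_measure W'
      (fun F => ∑' E : t ⁻¹' {F}, ENNReal.ofReal (vWF mob M W E.1.1.out))
    refine ⟨ν, fun G hG => ?_⟩
    simp only [hν]
    have key : ∀ G ∈ W', ∑' F : WSub W', (Nat.card (Epis F.1.out G) : ℝ≥0∞) *
        ∑' E : t ⁻¹' {F}, ENNReal.ofReal (vWF mob M W E.1.1.out) = ENNReal.ofReal (M (cls G)) := by
      intro G hG
      rw [← (hmom (hsub hG)).2, ← ENNReal.tsum_fiberwise _ t]
      refine tsum_congr (fun F => ?_)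
      rw [← ENNReal.tsum_mul_left]
      refine tsum_congr (fun E => ?_)
      have hE : t E.1 = F := E.2
      rw [← ht E.1 G hG, hE]
    refine real_moment _ _ (fun F => ?_) (hmom (hsub hG)).1 (key G hG)
    have h1 := key F.1.out F.2
    intro htop
    have h2 := ENNReal.le_tsum (f := fun F' : WSub W' => (Nat.card (Epis F'.1.out F.1.out) : ℝ≥0∞) *
        ∑' E : t ⁻¹' {F'}, ENNReal.ofReal (vWF mob M W E.1.1.out)) F
    rw [h1] at h2
    simp only [htop] at h2
    have : Nonempty (Epis F.1.out F.1.out) := ⟨⟨𝟙 _, inferInstance⟩⟩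
    rw [ENNReal.mul_top (by exact_mod_cast Nat.card_pos.ne')] at h2
    exact absurd (top_le_iff.mp h2) ENNReal.ofReal_ne_top
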